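/- arXiv:1806.02524 — 3 statements merged into one kernel-verified Lean document; each statement's English description precedes it below -/
import Mathlib

section
/- Let 𝒦 be a complete category. Then the free coproduct completion Σ𝒦 is locally cartesian closed if and only if 𝒦 is locally cartesian multi-closed (i.e., every slice category 𝒦/A is cartesian multi-closed). -/
/- Common definitions for formalizing "How nice are free completions of categories?"
   by Adámek and Rosický. -/

open CategoryTheory CategoryTheory.Limits

universe w w₁ w₂ v₁ u₁

namespace FreeCompletions

/-- A presheaf is *small* if it is a colimit of representables over a small
(`Type w`-indexed) diagram. -/
def IsSmallPresheaf {C : Type u₁} [Category.{v₁} C] (F : Cᵒᵖ ⥤ Type v₁) : Prop :=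
  ∃ (J : Type w) (_ : SmallCategory J) (D : J ⥤ C) (c : Cocone (D ⋙ yoneda)),
    Nonempty (IsColimit c) ∧ Nonempty (c.pt ≅ F)

/-- A presheaf is a (small) coproduct of representables. -/
def IsCoproductOfRepresentables {C : Type u₁} [Category.{v₁} C] (F : Cᵒᵖ ⥤ Type v₁) : Prop :=
  ∃ (I : Type v₁) (A : I → C), Nonempty (F ≅ ∐ fun i => yoneda.obj (A i))

/-- The free coproduct completion `Σ𝒦`, realized as the full subcategory of presheaves
consisting of coproducts of representables. -/
abbrev SigmaCompletion (K : Type u₁) [Category.{v₁} K] :=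
  ObjectProperty.FullSubcategory (IsCoproductOfRepresentables (C := K))

/-- The free colimit completion `𝒫𝒦`, the full subcategory of presheaves
consisting of the small presheaves. -/
abbrev PCompletion (K : Type u₁) [Category.{v₁} K] :=
  ObjectProperty.FullSubcategory (IsSmallPresheaf.{v₁} (C := K))

/-- The object of `Σ𝒦` given by a small family of objects of `𝒦`. -/
noncomputable def famObj {K : Type u₁} [Category.{v₁} K] {I : Type v₁} (B : I → K) :
    SigmaCompletion K :=
  ⟨∐ fun i => yoneda.obj (B i), ⟨I, B, ⟨Iso.refl _⟩⟩⟩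

theorem isSmallPresheaf_coprod {K : Type u₁} [Category.{v₁} K] {I : Type v₁} (B : I → K) :
    IsSmallPresheaf.{v₁} (∐ fun i => yoneda.obj (B i)) := by
  let G := Discrete.functor (fun i => yoneda.obj (B i))
  let e : Discrete.functor B ⋙ yoneda ≅ G := Discrete.natIso (fun i => Iso.refl _)
  exact ⟨Discrete I, inferInstance, Discrete.functor B,
    (Cocone.precompose e.hom).obj (colimit.cocone G),
    ⟨(IsColimit.precomposeHomEquiv e (colimit.cocone G)).symm (colimit.isColimit G)⟩,
    ⟨Iso.refl _⟩⟩

/-- The object of `𝒫𝒦` given by a small coproduct of representables. -/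
noncomputable def pcoprodObj {K : Type u₁} [Category.{v₁} K] {I : Type v₁} (B : I → K) :
    PCompletion K :=
  ⟨∐ fun i => yoneda.obj (B i), isSmallPresheaf_coprod B⟩

/-- A diagram `D` has a *multi-limit*: a set of cones through which every cone
factorizes uniquely (unique member and unique factorization). -/
def HasMultiLimit {J : Type w₁} [Category.{w₂} J] {C : Type u₁} [Category.{v₁} C]
    (D : J ⥤ C) : Prop :=
  ∃ (T : Type w) (c : T → Cone D), ∀ s : Cone D,
    ∃ p : Σ t : T, s ⟶ c t, ∀ q : Σ t : T, s ⟶ c t, q = p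

/-- `𝒦` is finitely multi-complete: every finite diagram has a multi-limit. -/
def FinitelyMultiComplete (C : Type u₁) [Category.{v₁} C] : Prop :=
  ∀ (J : Type) [SmallCategory J] [FinCategory J] (D : J ⥤ C), HasMultiLimit.{v₁} D

/-- A family `A : I → C` has a *multi-product*: a set of cones through which every cone
factorizes uniquely (unique member and unique factorization). -/
def HasMultiProduct {C : Type u₁} [Category.{v₁} C] {I : Type w₁} (A : I → C) : Prop :=
  ∃ (T : Type w) (P : T → C) (π : ∀ t i, P t ⟶ A i),
    ∀ (X : C) (f : ∀ i, X ⟶ A i),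
      ∃ p : Σ t : T, X ⟶ P t, (∀ i, p.2 ≫ π p.1 i = f i) ∧
        ∀ q : Σ t : T, X ⟶ P t, (∀ i, q.2 ≫ π q.1 i = f i) → q = p

/-- `C` has multi-products of all set-indexed families. -/
def HasMultiProducts (C : Type u₁) [Category.{v₁} C] : Prop :=
  ∀ (I : Type v₁) (A : I → C), HasMultiProduct.{v₁} A

/-- A diagram `D` has a *pre-limit*: a set of cones through which every cone
factorizes (not necessarily uniquely). -/
def HasPreLimit {J : Type w₁} [Category.{w₂} J] {C : Type u₁} [Category.{v₁} C]
    (D : J ⥤ C) : Prop :=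
  ∃ (T : Type w) (c : T → Cone D), ∀ s : Cone D, ∃ t : T, Nonempty (s ⟶ c t)

/-- `C` is pre-complete: every small diagram has a pre-limit. -/
def PreComplete (C : Type u₁) [Category.{v₁} C] : Prop :=
  ∀ (J : Type v₁) [SmallCategory J] (D : J ⥤ C), HasPreLimit.{v₁} D

/-- `C` is finitely pre-complete: every finite diagram has a pre-limit. -/
def FinitelyPreComplete (C : Type u₁) [Category.{v₁} C] : Prop :=
  ∀ (J : Type) [SmallCategory J] [FinCategory J] (D : J ⥤ C), HasPreLimit.{v₁} D

/-- A family `A : I → C` has a *pre-product*: a set of cones through which every cone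
factorizes (not necessarily uniquely). -/
def HasPreProduct {C : Type u₁} [Category.{v₁} C] {I : Type w₁} (A : I → C) : Prop :=
  ∃ (T : Type w) (P : T → C) (π : ∀ t i, P t ⟶ A i),
    ∀ (X : C) (f : ∀ i, X ⟶ A i), ∃ (t : T) (h : X ⟶ P t), ∀ i, h ≫ π t i = f i

/-- `C` (with finite products) is cartesian multi-closed: each functor `A × -` is a
left multi-adjoint. -/
def CartesianMultiClosedOf (C : Type u₁) [Category.{v₁} C] [HasFiniteProducts C] : Prop :=
  ∀ A B : C, ∃ (I : Type v₁) (E : I → C) (ev : ∀ i, A ⨯ E i ⟶ B),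
    ∀ (X : C) (c : A ⨯ X ⟶ B),
      ∃ p : Σ i : I, X ⟶ E i, (prod.map (𝟙 A) p.2 ≫ ev p.1 = c) ∧
        ∀ q : Σ i : I, X ⟶ E i, prod.map (𝟙 A) q.2 ≫ ev q.1 = c → q = p

/-- `C` is cartesian multi-closed: it has finite products and each functor `A × -` is a
left multi-adjoint. -/
def CartesianMultiClosed (C : Type u₁) [Category.{v₁} C] : Prop :=
  ∃ h : HasFiniteProducts C, @CartesianMultiClosedOf C _ h

/-- `C` is cartesian closed (as a property: it has finite products and each `A × -`
is a left adjoint). -/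
def CartesianClosedP (C : Type u₁) [Category.{v₁} C] : Prop :=
  ∃ h : CartesianMonoidalCategory C, Nonempty (@MonoidalClosed C _ h.toMonoidalCategory)

/-- `C` is locally cartesian closed: every slice category is cartesian closed. -/
def LocallyCartesianClosedP (C : Type u₁) [Category.{v₁} C] : Prop :=
  ∀ A : C, CartesianClosedP (Over A)

/-- `C` is locally cartesian multi-closed: every slice category is cartesian multi-closed. -/
def LocallyCartesianMultiClosed (C : Type u₁) [Category.{v₁} C] : Prop :=
  ∀ A : C, CartesianMultiClosed (Over A)

/-- `C` (with finite products) is cartesian pre-closed: each functor `C(A × -, B)`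
is a small presheaf. -/
def CartesianPreClosedOf (C : Type u₁) [Category.{v₁} C] [HasFiniteProducts C] : Prop :=
  ∀ A B : C, IsSmallPresheaf.{w} ((prod.functor.obj A).op ⋙ yoneda.obj B)

/-- `C` is cartesian pre-closed: it has finite products and each functor `C(A × -, B)`
is a small presheaf. -/
def CartesianPreClosed (C : Type u₁) [Category.{v₁} C] : Prop :=
  ∃ h : HasFiniteProducts C, @CartesianPreClosedOf.{w} C _ h

/-- `C` (with binary products) has weak simple products. -/
def HasWeakSimpleProductsOf (C : Type u₁) [Category.{v₁} C] [HasBinaryProducts C] : Prop :=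
  ∀ (A X B : C) (b : B ⟶ A ⨯ X),
    ∃ (P : C) (ε : A ⨯ P ⟶ B) (w : P ⟶ X),
      ε ≫ b = prod.map (𝟙 A) w ∧
      ∀ (P' : C) (ε' : A ⨯ P' ⟶ B) (w' : P' ⟶ X), ε' ≫ b = prod.map (𝟙 A) w' →
        ∃ f : P' ⟶ P, ε' = prod.map (𝟙 A) f ≫ ε ∧ w' = f ≫ w

/-- `C` has binary products and weak simple products. -/
def HasWeakSimpleProducts (C : Type u₁) [Category.{v₁} C] : Prop :=
  ∃ h : HasBinaryProducts C, @HasWeakSimpleProductsOf C _ h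

/-- `C` has a subobject classifier: a mono `ε : 1 ⟶ Ω` from the terminal object such that
every monomorphism is a pullback of `ε` along a unique morphism. -/
def HasSubobjectClassifierP (C : Type u₁) [Category.{v₁} C] : Prop :=
  ∃ (T Ω : C) (hT : IsTerminal T) (ε : T ⟶ Ω), Mono ε ∧
    ∀ ⦃U X : C⦄ (m : U ⟶ X), Mono m → ∃! χ : X ⟶ Ω, IsPullback (hT.from U) m ε χ

/-- `C` is an elementary topos: finitely complete, cartesian closed,
with a subobject classifier. -/
def IsElementaryTopos (C : Type u₁) [Category.{v₁} C] : Prop :=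
  HasFiniteLimits C ∧ CartesianClosedP C ∧ HasSubobjectClassifierP C

/-- `C` is a multi-topos: finitely complete, cartesian multi-closed,
with a subobject classifier. -/
def IsMultiTopos (C : Type u₁) [Category.{v₁} C] : Prop :=
  HasFiniteLimits C ∧ CartesianMultiClosed C ∧ HasSubobjectClassifierP C

/-- A coproduct cocone is *universal*: it is stable under pullback. -/
def CofanUniversal {C : Type u₁} [Category.{v₁} C] {I : Type w₁} {X : I → C}
    (c : Cofan X) : Prop :=
  ∀ {W : C} (h : W ⟶ c.pt) (Y : I → C) (p : ∀ i, Y i ⟶ W) (q : ∀ i, Y i ⟶ X i),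
    (∀ i, IsPullback (p i) (q i) h (c.inj i)) → Nonempty (IsColimit (Cofan.mk W p))

/-- A coproduct cocone is *disjoint*: injections are monic with initial pairwise
intersections. -/
def CofanDisjoint {C : Type u₁} [Category.{v₁} C] {I : Type w₁} {X : I → C}
    (c : Cofan X) : Prop :=
  (∀ i, Mono (c.inj i)) ∧
    ∀ i j, i ≠ j → ∀ {Z : C} (u : Z ⟶ X i) (v : Z ⟶ X j),
      IsPullback u v (c.inj i) (c.inj j) → Nonempty (IsInitial Z)

/-- `C` is extensive: finitely complete, with finite coproducts which are
universal and disjoint. -/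
def IsExtensive (C : Type u₁) [Category.{v₁} C] : Prop :=
  HasFiniteLimits C ∧ HasFiniteCoproducts C ∧
    ∀ (I : Type) [Finite I] (X : I → C) (c : Cofan X),
      Nonempty (IsColimit c) → CofanUniversal c ∧ CofanDisjoint c

/-- `C` is infinitary extensive: finitely complete, with small (`Type w`-indexed)
coproducts which are universal and disjoint. -/
def IsInfinitaryExtensive (C : Type u₁) [Category.{v₁} C] : Prop :=
  HasFiniteLimits C ∧ HasCoproducts.{w} C ∧
    ∀ (I : Type w) (X : I → C) (c : Cofan X),
      Nonempty (IsColimit c) → CofanUniversal c ∧ CofanDisjoint c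

/-- A parallel pair `r₁ r₂ : R ⟶ X` is an (internal) equivalence relation. -/
structure IsEquivalenceRelationPair {C : Type u₁} [Category.{v₁} C] {R X : C}
    (r₁ r₂ : R ⟶ X) : Prop where
  jointlyMono : ∀ {Z : C} (a b : Z ⟶ R), a ≫ r₁ = b ≫ r₁ → a ≫ r₂ = b ≫ r₂ → a = b
  refl : ∀ {Z : C} (f : Z ⟶ X), ∃ d : Z ⟶ R, d ≫ r₁ = f ∧ d ≫ r₂ = f
  symm : ∃ s : R ⟶ R, s ≫ r₁ = r₂ ∧ s ≫ r₂ = r₁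
  trans : ∀ {Z : C} (a b : Z ⟶ R), a ≫ r₂ = b ≫ r₁ →
    ∃ t : Z ⟶ R, t ≫ r₁ = a ≫ r₁ ∧ t ≫ r₂ = b ≫ r₂

/-- `C` is a regular category: finitely complete, with (regular epi, mono)
factorizations, and regular epimorphisms are stable under pullback. -/
def IsRegularCat (C : Type u₁) [Category.{v₁} C] : Prop :=
  HasFiniteLimits C ∧
    (∀ {X Y : C} (f : X ⟶ Y), ∃ (Z : C) (e : X ⟶ Z) (m : Z ⟶ Y),
      e ≫ m = f ∧ Nonempty (RegularEpi e) ∧ Mono m) ∧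
    (∀ {P X Y Z : C} (fst : P ⟶ X) (snd : P ⟶ Y) (f : X ⟶ Z) (g : Y ⟶ Z),
      IsPullback fst snd f g → Nonempty (RegularEpi g) → Nonempty (RegularEpi fst))

/-- `C` is an exact (Barr-exact) category: regular with effective equivalence relations. -/
def IsExactCat (C : Type u₁) [Category.{v₁} C] : Prop :=
  IsRegularCat C ∧
    ∀ {R X : C} (r₁ r₂ : R ⟶ X), IsEquivalenceRelationPair r₁ r₂ →
      ∃ (Y : C) (f : X ⟶ Y), IsPullback r₁ r₂ f f

/-- A pretopos is an exact and extensive category. -/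
def IsPretopos (C : Type u₁) [Category.{v₁} C] : Prop :=
  IsExactCat C ∧ IsExtensive C

/-- `C` is additive: preadditive with finite biproducts. -/
def IsAdditive (C : Type u₁) [Category.{v₁} C] : Prop :=
  ∃ p : Preadditive C, letI := p; HasFiniteBiproducts C

/-- `C` is wellpowered: every object has only a set of subobjects. -/
def Wellpowered (C : Type u₁) [Category.{v₁} C] : Prop :=
  ∀ X : C, Small.{w} (Subobject X)

/-- `C` is cowellpowered: every object has only a set of quotient objects. -/
def Cowellpowered (C : Type u₁) [Category.{v₁} C] : Prop :=
  ∀ X : C, Small.{w} (Subobject (Opposite.op X))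

/-- `C` has a clique-like class of objects, indexed by all ordinals. -/
def HasCliqueLikeClass (C : Type u₁) [Category.{v₁} C] : Prop :=
  ∃ (A : Ordinal.{v₁} → C) (R : MorphismProperty C),
    (∀ {X Y Z : C} (v : X ⟶ Y) (u : Y ⟶ Z), R (v ≫ u) → R u) ∧
    (∀ k, ∃ f g : A 0 ⟶ A k, f ≠ g ∧ R f ∧ R g) ∧
    ((∀ i k : Ordinal.{v₁}, 0 < i → i < k → ∀ f : A k ⟶ A i, ¬ R f) ∨
     (∀ k i : Ordinal.{v₁}, 0 < k → k < i → ∀ f : A k ⟶ A i, ¬ R f))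

/-- A presheaf is petty: a quotient of a small coproduct of representables. -/
def IsPetty {C : Type u₁} [Category.{v₁} C] (F : Cᵒᵖ ⥤ Type v₁) : Prop :=
  ∃ (I : Type v₁) (A : I → C) (e : (∐ fun i => yoneda.obj (A i)) ⟶ F), Epi e

/-- A presheaf is lucid: petty, and equalizers of pairs of morphisms from petty
presheaves into it are petty. -/
noncomputable def IsLucid {C : Type u₁} [Category.{v₁} C] (F : Cᵒᵖ ⥤ Type v₁) : Prop :=
  IsPetty F ∧ ∀ (P : Cᵒᵖ ⥤ Type v₁), IsPetty P → ∀ u₁ u₂ : P ⟶ F, IsPetty (equalizer u₁ u₂)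

universe v u

open Opposite

section MultiRepSection

variable {C : Type u} [Category.{v} C]

/-- A presheaf is multi-representable if it is (elementwise) a small coproduct of
representables. -/
def MultiRep (G : Cᵒᵖ ⥤ Type w) : Prop :=
  ∃ (I : Type v) (A : I → C) (a : ∀ i, G.obj (op (A i))),
    ∀ (Z : C) (z : G.obj (op Z)), ∃! p : Σ i, (Z ⟶ A i), G.map p.2.op (a p.1) = z

theorem psh_comp (G : Cᵒᵖ ⥤ Type w) {X Y Z : C} (f : X ⟶ Y) (g : Y ⟶ Z) (z : G.obj (op Z)) :
    G.map (f ≫ g).op z = G.map f.op (G.map g.op z) := by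
  rw [op_comp, G.map_comp]
  rfl

theorem psh_id (G : Cᵒᵖ ⥤ Type w) {Z : C} (z : G.obj (op Z)) :
    G.map (𝟙 Z).op z = z := by
  rw [op_id, G.map_id]
  rfl

theorem psh_nat {G H : Cᵒᵖ ⥤ Type w} (m : G ⟶ H) {Y Z : C} (f : Y ⟶ Z) (z : G.obj (op Z)) :
    m.app (op Y) (G.map f.op z) = H.map f.op (m.app (op Z) z) :=
  NatTrans.naturality_apply m f.op z

/-- The explicit coproduct of representables. -/
def sigmaPsh {I : Type v} (A : I → C) : Cᵒᵖ ⥤ Type v where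
  obj Z := Σ i, (Z.unop ⟶ A i)
  map f := ↾ fun p => ⟨p.1, f.unop ≫ p.2⟩

def sigmaPshCofan {I : Type v} (A : I → C) : Cofan (fun i => yoneda.obj (A i)) :=
  Cofan.mk (sigmaPsh A) fun i => { app := fun Z => ↾ fun f => ⟨i, f⟩ }

def sigmaPshIsColimit {I : Type v} (A : I → C) : IsColimit (sigmaPshCofan A) :=
  Cofan.IsColimit.mk _
    (fun s => { app := fun Z => ↾ fun p => (s.inj p.1).app Z p.2
                naturality := by
                  intro X Y f
                  ext ⟨i, p⟩
                  exact NatTrans.naturality_apply (s.inj i) f p })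
    (fun s i => by ext Z f; rfl)
    (fun s m h => by
      ext Z ⟨i, p⟩
      have := h i
      have := congrArg (fun k => k.app Z p) this
      exact this)

theorem multiRep_sigmaPsh {I : Type v} (A : I → C) : MultiRep (sigmaPsh A) :=
  ⟨I, A, fun i => ⟨i, 𝟙 _⟩, fun Z z => ⟨z, by
    obtain ⟨i, f⟩ := z
    exact congrArg (Sigma.mk i) (Category.comp_id f), by
    rintro ⟨j, g⟩ h
    rw [← h]
    exact congrArg (Sigma.mk j) (Category.comp_id g).symm⟩⟩

theorem MultiRep.of_bij {G : Cᵒᵖ ⥤ Type w} {H : Cᵒᵖ ⥤ Type w₁} (hG : MultiRep G)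
    (m : ∀ Z : C, G.obj (op Z) → H.obj (op Z))
    (nat : ∀ (Z Z' : C) (f : Z' ⟶ Z) (z : G.obj (op Z)),
      m Z' (G.map f.op z) = H.map f.op (m Z z))
    (bij : ∀ Z, Function.Bijective (m Z)) : MultiRep H := by
  obtain ⟨I, A, a, h⟩ := hG
  refine ⟨I, A, fun i => m _ (a i), fun Z z => ?_⟩
  obtain ⟨y, rfl⟩ := (bij Z).2 z
  obtain ⟨p, hp, hu⟩ := h Z y
  refine ⟨p, ?_, ?_⟩
  · dsimp only at hp ⊢
    rw [← nat, hp]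
  · intro q hq
    dsimp only at hq
    rw [← nat] at hq
    exact hu q ((bij Z).1 hq)

theorem isCoproductOfRepresentables_iff (F : Cᵒᵖ ⥤ Type v) :
    IsCoproductOfRepresentables F ↔ MultiRep F := by
  constructor
  · rintro ⟨I, A, ⟨e⟩⟩
    let e' : sigmaPsh A ≅ F :=
      ((sigmaPshIsColimit A).coconePointUniqueUpToIso (colimit.isColimit _)) ≪≫ e.symm
    refine (multiRep_sigmaPsh A).of_bij (fun Z => e'.hom.app (op Z)) ?_ ?_
    · intro Z Z' f z
      exact NatTrans.naturality_apply e'.hom f.op z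
    · intro Z
      exact (((e'.app (op Z)).toEquiv).bijective)
  · rintro ⟨I, A, a, h⟩
    let m : sigmaPsh A ⟶ F :=
      { app := fun Z => ↾ fun p => F.map p.2.op (a p.1)
        naturality := by
          intro X Y f
          ext p
          exact psh_comp F f.unop p.2 (a p.1) }
    have : ∀ Z, IsIso (m.app Z) := by
      intro Z
      rw [isIso_iff_bijective]
      constructor
      · intro p q hpq
        exact (h Z.unop (F.map p.2.op (a p.1))).unique rfl hpq.symm
      · intro z
        obtain ⟨p, hp, -⟩ := h Z.unop z
        exact ⟨p, hp⟩
    have : IsIso m := NatIso.isIso_of_isIso_app m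
    exact ⟨I, A, ⟨(asIso m).symm ≪≫
      ((sigmaPshIsColimit A).coconePointUniqueUpToIso (colimit.isColimit _))⟩⟩

end MultiRepSection

section CLevel

variable {C : Type u} [Category.{v} C]

/-- Coproduct of presheaves. -/
def sigmaFun {κ : Type v} (G : κ → Cᵒᵖ ⥤ Type v) : Cᵒᵖ ⥤ Type v where
  obj Z := Σ k, (G k).obj Z
  map f := ↾ fun p => ⟨p.1, (G p.1).map f p.2⟩

/-- Product of presheaves. -/
def piFun {κ : Type v} (G : κ → Cᵒᵖ ⥤ Type v) : Cᵒᵖ ⥤ Type v where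
  obj Z := ∀ k, (G k).obj Z
  map f := ↾ fun p k => (G k).map f (p k)

theorem multiRep_sigmaFun {κ : Type v} (G : κ → Cᵒᵖ ⥤ Type v) (h : ∀ k, MultiRep (G k)) :
    MultiRep (sigmaFun G) := by
  choose I A a ha using h
  refine ⟨Σ k, I k, fun t => A t.1 t.2, fun t => ⟨t.1, a t.1 t.2⟩, ?_⟩
  rintro Z ⟨k, z⟩
  obtain ⟨p, hp, hu⟩ := ha k Z z
  refine ⟨⟨⟨k, p.1⟩, p.2⟩, congrArg (Sigma.mk k) hp, ?_⟩
  rintro ⟨⟨k', i⟩, f⟩ hq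
  change (⟨k', (G k').map f.op (a k' i)⟩ : Σ k, (G k).obj (op Z)) = ⟨k, z⟩ at hq
  obtain ⟨rfl, hq⟩ := Sigma.mk.inj_iff.1 hq
  have := hu ⟨i, f⟩ (eq_of_heq hq)
  subst this
  rfl

theorem multiRep_piFun [HasProducts.{v} C] {κ : Type v} (G : κ → Cᵒᵖ ⥤ Type v)
    (h : ∀ k, MultiRep (G k)) : MultiRep (piFun G) := by
  choose I A a ha using h
  refine ⟨∀ k, I k, fun φ => ∏ᶜ fun k => A k (φ k),
    fun φ k => (G k).map (Pi.π _ k).op (a k (φ k)), ?_⟩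
  intro Z z
  choose p hp hu using fun k => ha k Z (z k)
  refine ⟨⟨fun k => (p k).1, Pi.lift fun k => (p k).2⟩, ?_, ?_⟩
  · funext k
    change (G k).map _ ((G k).map _ _) = _
    rw [← psh_comp, Pi.lift_π]
    exact hp k
  · rintro ⟨φ, f⟩ hq
    have key : ∀ k, (⟨φ k, f ≫ Pi.π _ k⟩ : Σ i, (Z ⟶ A k i)) = p k := by
      intro k
      apply hu k
      dsimp only
      rw [psh_comp]
      exact congrFun hq k
    have hp' : p = fun k => ⟨φ k, f ≫ Pi.π _ k⟩ := funext fun k => (key k).symm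
    subst hp'
    refine congrArg (Sigma.mk φ) ?_
    apply Pi.hom_ext
    intro k
    rw [Pi.lift_π]

/-- Binary product of presheaves. -/
def prodFun (G H : Cᵒᵖ ⥤ Type v) : Cᵒᵖ ⥤ Type v where
  obj Z := G.obj Z × H.obj Z
  map f := ↾ fun p => (G.map f p.1, H.map f p.2)

theorem multiRep_prodFun [HasBinaryProducts C] {G H : Cᵒᵖ ⥤ Type v}
    (hG : MultiRep G) (hH : MultiRep H) : MultiRep (prodFun G H) := by
  obtain ⟨I, A, a, ha⟩ := hG
  obtain ⟨J, B, b, hb⟩ := hH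
  refine ⟨I × J, fun t => A t.1 ⨯ B t.2,
    fun t => (G.map prod.fst.op (a t.1), H.map prod.snd.op (b t.2)), ?_⟩
  rintro Z ⟨z, z'⟩
  obtain ⟨p, hp, hpu⟩ := ha Z z
  obtain ⟨q, hq, hqu⟩ := hb Z z'
  refine ⟨⟨(p.1, q.1), prod.lift p.2 q.2⟩, ?_, ?_⟩
  · apply Prod.ext
    · change G.map _ (G.map _ _) = _
      rw [← psh_comp, prod.lift_fst]
      exact hp
    · change H.map _ (H.map _ _) = _
      rw [← psh_comp, prod.lift_snd]
      exact hq
  · rintro ⟨⟨i, j⟩, f⟩ hf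
    have h1 : G.map f.op (G.map prod.fst.op (a i)) = z := congrArg Prod.fst hf
    have h2 : H.map f.op (H.map prod.snd.op (b j)) = z' := congrArg Prod.snd hf
    rw [← psh_comp] at h1 h2
    have e1 := hpu ⟨i, _⟩ h1
    have e2 := hqu ⟨j, _⟩ h2
    subst e1 e2
    refine congrArg (Sigma.mk (i, j)) ?_
    apply prod.hom_ext
    · exact (prod.lift_fst _ _).symm
    · exact (prod.lift_snd _ _).symm

/-- Natural families `y Z × X ⟶ B`. -/
@[ext]
structure CFam (X B : Cᵒᵖ ⥤ Type v) (Z : C) where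
  toFun : ∀ ⦃W : C⦄ (_ : W ⟶ Z), X.obj (op W) → B.obj (op W)
  nat : ∀ ⦃W W' : C⦄ (h : W' ⟶ W) (g : W ⟶ Z) (x : X.obj (op W)),
    toFun (h ≫ g) (X.map h.op x) = B.map h.op (toFun g x)

/-- The presheaf exponential (in a larger universe). -/
def cfam (X B : Cᵒᵖ ⥤ Type v) : Cᵒᵖ ⥤ Type (max u v) where
  obj Z := CFam X B Z.unop
  map f := ↾ fun θ => ⟨fun W g x => θ.toFun (g ≫ f.unop) x, fun W W' h g x => by
    rw [Category.assoc]; exact θ.nat h _ x⟩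
  map_id Z := by
    ext θ W g x
    change θ.toFun (g ≫ 𝟙 _) x = θ.toFun g x
    rw [Category.comp_id]
  map_comp f f' := by
    ext θ W g x
    change θ.toFun (g ≫ f'.unop ≫ f.unop) x = θ.toFun ((g ≫ f'.unop) ≫ f.unop) x
    rw [Category.assoc]

theorem multiRep_cfam [HasFiniteProducts C] [HasProducts.{v} C] (hC : CartesianMultiClosedOf C)
    {X B : Cᵒᵖ ⥤ Type v} (hX : MultiRep X) (hB : MultiRep B) : MultiRep (cfam X B) := by
  obtain ⟨J, Xo, x, hx⟩ := hX
  obtain ⟨T, Bo, b, hb⟩ := hB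
  have h1 : ∀ j k, MultiRep ((prod.functor.obj (Xo j)).op ⋙ yoneda.obj (Bo k)) := by
    intro j k
    obtain ⟨I, E, ev, h⟩ := hC (Xo j) (Bo k)
    exact ⟨I, E, ev, fun Z z => h Z z⟩
  have h2 := multiRep_piFun _ fun j => multiRep_sigmaFun _ (h1 j)
  choose p hp hpu using hx
  have hp' : ∀ (W : C) (j : J) (α : W ⟶ Xo j), p W (X.map α.op (x j)) = ⟨j, α⟩ :=
    fun W j α => (hpu W _ ⟨j, α⟩ rfl).symm
  let m : ∀ (Z : C), (∀ j, Σ k, (Xo j ⨯ Z ⟶ Bo k)) → ∀ W (g : W ⟶ Z) (y : X.obj (op W)),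
      B.obj (op W) := fun Z w W g y =>
    B.map (prod.lift (p W y).2 g ≫ (w (p W y).1).2).op (b (w (p W y).1).1)
  have hm : ∀ Z w W g j (α : W ⟶ Xo j), m Z w W g (X.map α.op (x j)) =
      B.map (prod.lift α g ≫ (w j).2).op (b (w j).1) := by
    intro Z w W g j α
    dsimp only [m]
    rw [hp']
  have hind : ∀ (W : C) (y : X.obj (op W)), ∃ (j : J) (α : W ⟶ Xo j), y = X.map α.op (x j) :=
    fun W y => ⟨(p W y).1, (p W y).2, (hp W y).symm⟩
  have hm1 : ∀ Z w W W' (h : W' ⟶ W) (g : W ⟶ Z) (y : X.obj (op W)),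
      m Z w W' (h ≫ g) (X.map h.op y) = B.map h.op (m Z w W g y) := by
    intro Z w W W' h g y
    obtain ⟨j, α, rfl⟩ := hind W y
    rw [← psh_comp, hm, hm, ← psh_comp, ← Category.assoc, prod.comp_lift]
  have hm2 : ∀ Z Z' (f : Z' ⟶ Z) (w : ∀ j, Σ k, (Xo j ⨯ Z ⟶ Bo k)) W (g : W ⟶ Z')
      (y : X.obj (op W)), m Z' (fun j => ⟨(w j).1, prod.map (𝟙 _) f ≫ (w j).2⟩) W g y =
        m Z w W (g ≫ f) y := by
    intro Z Z' f w W g y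
    obtain ⟨j, α, rfl⟩ := hind W y
    refine (hm Z' (fun j => ⟨(w j).1, prod.map (𝟙 _) f ≫ (w j).2⟩) W g j α).trans ?_
    rw [hm]
    dsimp only
    rw [← Category.assoc, prod.lift_map, Category.comp_id]
  have hm3 : ∀ Z w w', m Z w = m Z w' → w = w' := by
    intro Z w w' h
    funext j
    have h3 : m Z w _ prod.snd (X.map prod.fst.op (x j)) =
        m Z w' _ prod.snd (X.map prod.fst.op (x j)) := by rw [h]
    rw [hm, hm] at h3
    simp only [prod.lift_fst_snd, Category.id_comp] at h3
    exact (hb _ _).unique h3 rfl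
  refine h2.of_bij (fun Z w => ⟨m Z w, ?_⟩) ?_ ?_
  · intro W W' h g y
    exact hm1 Z w W W' h g y
  · intro Z Z' f w
    apply CFam.ext
    funext W g y
    exact hm2 Z Z' f w W g y
  · intro Z
    constructor
    · intro w w' h
      exact hm3 Z w w' (congrArg CFam.toFun h)
    · intro θ
      choose w hw using fun j => (hb _ (θ.toFun prod.snd (X.map prod.fst.op (x j)))).exists
      refine ⟨w, ?_⟩
      apply CFam.ext
      funext W g y
      obtain ⟨j, α, rfl⟩ := hind W y
      refine (hm _ _ _ _ _ _).trans ?_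
      rw [psh_comp, hw, ← θ.nat, ← psh_comp, prod.lift_fst, prod.lift_snd]

end CLevel

section Slices

variable {K : Type u} [Category.{v} K]

/-- Restriction of a presheaf over `F` along an element of `F`. -/
def Res {X F : Kᵒᵖ ⥤ Type v} (q : X ⟶ F) {A : K} (a : F.obj (op A)) :
    (Over A)ᵒᵖ ⥤ Type v where
  obj W := {x : X.obj (op W.unop.left) // q.app _ x = F.map W.unop.hom.op a}
  map f := ↾ fun x => ⟨X.map f.unop.left.op x.1, by
    rw [psh_nat, x.2, ← psh_comp, Over.w]⟩
  map_id W := by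
    ext x
    exact psh_id X x.1
  map_comp f g := by
    ext x
    exact psh_comp X g.unop.left f.unop.left x.1

theorem multiRep_res {X F : Kᵒᵖ ⥤ Type v} (q : X ⟶ F) (hX : MultiRep X)
    {I : Type v} {A : I → K} {a : ∀ i, F.obj (op (A i))}
    (ha : ∀ (Z : K) (z : F.obj (op Z)), ∃! p : Σ i, (Z ⟶ A i), F.map p.2.op (a p.1) = z)
    (i : I) : MultiRep (Res q (a i)) := by
  obtain ⟨J, Xo, x, hx⟩ := hX
  refine ⟨{jr : Σ j, (Xo j ⟶ A i) // q.app _ (x jr.1) = F.map jr.2.op (a i)},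
    fun t => Over.mk t.1.2, fun t => ⟨x t.1.1, t.2⟩, ?_⟩
  rintro W ⟨y, hy⟩
  obtain ⟨⟨j, α⟩, hα, hu⟩ := hx W.left y
  dsimp only at hα
  subst hα
  obtain ⟨⟨i', r⟩, hr, -⟩ := ha _ (q.app _ (x j))
  dsimp only at hr
  have h1 : (⟨i', α ≫ r⟩ : Σ i, (W.left ⟶ A i)) = ⟨i, W.hom⟩ := by
    refine (ha W.left _).unique ?_ hy.symm
    dsimp only
    rw [psh_comp, hr]
    exact (psh_nat q α (x j)).symm
  obtain ⟨rfl, h2⟩ := Sigma.mk.inj_iff.1 h1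
  have h2 := eq_of_heq h2
  refine ⟨⟨⟨⟨j, r⟩, hr.symm⟩, Over.homMk α h2⟩, Subtype.ext rfl, ?_⟩
  rintro ⟨⟨⟨j', r'⟩, hr'⟩, f⟩ hf
  have hf := congrArg Subtype.val hf
  have h3 := hu ⟨j', f.left⟩ hf
  obtain ⟨rfl, h4⟩ := Sigma.mk.inj_iff.1 h3
  have h4 := eq_of_heq h4
  have h5 : (⟨i', r'⟩ : Σ i, (Xo j' ⟶ A i)) = ⟨i', r⟩ := (ha _ _).unique hr'.symm hr
  have h5 := eq_of_heq (Sigma.mk.inj_iff.1 h5).2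
  subst h5
  refine congrArg (Sigma.mk _) ?_
  ext
  exact h4

theorem multiRep_total {H F : Kᵒᵖ ⥤ Type v} (q : H ⟶ F)
    {I : Type v} {A : I → K} {a : ∀ i, F.obj (op (A i))}
    (ha : ∀ (Z : K) (z : F.obj (op Z)), ∃! p : Σ i, (Z ⟶ A i), F.map p.2.op (a p.1) = z)
    (hq : ∀ i, MultiRep (Res q (a i))) : MultiRep H := by
  choose T E e he using hq
  refine ⟨Σ i, T i, fun t => (E t.1 t.2).left, fun t => (e t.1 t.2).1, ?_⟩
  intro Z y
  obtain ⟨⟨i, z⟩, hz, hzu⟩ := ha Z (q.app _ y)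
  dsimp only at hz
  obtain ⟨⟨τ, f⟩, hf, hfu⟩ := he i (Over.mk z) ⟨y, hz.symm⟩
  refine ⟨⟨⟨i, τ⟩, f.left⟩, congrArg Subtype.val hf, ?_⟩
  rintro ⟨⟨i', τ'⟩, f'⟩ hf'
  dsimp only at hf'
  have h1 := hzu ⟨i', f' ≫ (E i' τ').hom⟩ (by
    dsimp only
    rw [psh_comp, ← hf', psh_nat, (e i' τ').2])
  obtain ⟨rfl, h2⟩ := Sigma.mk.inj_iff.1 h1
  have h2 := eq_of_heq h2
  have h3 := hfu ⟨τ', Over.homMk f' h2⟩ (Subtype.ext hf')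
  exact congrArg (fun p : Σ t, (Over.mk z ⟶ E i' t) =>
    (⟨⟨i', p.1⟩, p.2.left⟩ : Σ t : (Σ i, T i), (Z ⟶ (E t.1 t.2).left))) h3

/-- Explicit pullback of presheaves. -/
def PB {X Y F : Kᵒᵖ ⥤ Type v} (p : X ⟶ F) (q : Y ⟶ F) : Kᵒᵖ ⥤ Type v where
  obj Z := {xy : X.obj Z × Y.obj Z // p.app Z xy.1 = q.app Z xy.2}
  map f := ↾ fun xy => ⟨(X.map f xy.1.1, Y.map f xy.1.2), by
    rw [NatTrans.naturality_apply, NatTrans.naturality_apply, xy.2]⟩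

def PBfst {X Y F : Kᵒᵖ ⥤ Type v} (p : X ⟶ F) (q : Y ⟶ F) : PB p q ⟶ X where
  app Z := ↾ fun xy => xy.1.1

def PBsnd {X Y F : Kᵒᵖ ⥤ Type v} (p : X ⟶ F) (q : Y ⟶ F) : PB p q ⟶ Y where
  app Z := ↾ fun xy => xy.1.2

theorem PB_cond {X Y F : Kᵒᵖ ⥤ Type v} (p : X ⟶ F) (q : Y ⟶ F) :
    PBfst p q ≫ p = PBsnd p q ≫ q := by
  ext Z xy
  exact xy.2

def PBlift {X Y F W : Kᵒᵖ ⥤ Type v} (p : X ⟶ F) (q : Y ⟶ F) (f : W ⟶ X) (g : W ⟶ Y)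
    (h : f ≫ p = g ≫ q) : W ⟶ PB p q where
  app Z := ↾ fun w => ⟨(f.app Z w, g.app Z w), congrArg (fun k => k.app Z w) h⟩
  naturality Z Z' k := by
    ext w
    apply Subtype.ext
    have h1 := NatTrans.naturality_apply f k w
    have h2 := NatTrans.naturality_apply g k w
    exact Prod.ext h1 h2

theorem multiRep_PB {X Y F : Kᵒᵖ ⥤ Type v} (p : X ⟶ F) (q : Y ⟶ F)
    [∀ A : K, HasBinaryProducts (Over A)]
    (hF : MultiRep F) (hX : MultiRep X) (hY : MultiRep Y) : MultiRep (PB p q) := by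
  obtain ⟨I, A, a, ha⟩ := hF
  refine multiRep_total (PBfst p q ≫ p) ha fun i => ?_
  refine (multiRep_prodFun (multiRep_res p hX ha i) (multiRep_res q hY ha i)).of_bij
    (fun W z => ⟨⟨(z.1.1, z.2.1), z.1.2.trans z.2.2.symm⟩, z.1.2⟩) ?_ ?_
  · intro Z Z' f z
    rfl
  · intro Z
    constructor
    · rintro ⟨⟨z, hz⟩, ⟨z', hz'⟩⟩ ⟨⟨w, hw⟩, ⟨w', hw'⟩⟩ h
      have h := congrArg (fun k => k.1.1) h
      obtain ⟨rfl, rfl⟩ := Prod.mk.inj h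
      rfl
    · rintro ⟨⟨⟨z, z'⟩, h⟩, h'⟩
      exact ⟨⟨⟨z, h'⟩, ⟨z', h.symm.trans h'⟩⟩, rfl⟩

end Slices

section Exp

variable {K : Type u} [Category.{v} K]

theorem exists_exp {F X B : Kᵒᵖ ⥤ Type v} (p : X ⟶ F) (b : B ⟶ F)
    {I : Type v} {A : I → K} {a : ∀ i, F.obj (op (A i))}
    (ha : ∀ (Z : K) (z : F.obj (op Z)), ∃! p : Σ i, (Z ⟶ A i), F.map p.2.op (a p.1) = z)
    (hexp : ∀ i, MultiRep (cfam (Res p (a i)) (Res b (a i)))) :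
    ∃ (E : Kᵒᵖ ⥤ Type v) (e : E ⟶ F) (ev : PB p e ⟶ B), MultiRep E ∧
      ev ≫ b = PBfst p e ≫ p ∧
      ∀ (Y : Kᵒᵖ ⥤ Type v) (q : Y ⟶ F) (c : PB p q ⟶ B), c ≫ b = PBfst p q ≫ p →
        ∃! h : Y ⟶ E, h ≫ e = q ∧ ∀ (Z : K) (x : X.obj (op Z)) (y : Y.obj (op Z))
          (h1 : p.app _ x = q.app _ y) (h2 : p.app _ x = e.app _ (h.app _ y)),
          ev.app (op Z) ⟨(x, h.app _ y), h2⟩ = c.app (op Z) ⟨(x, y), h1⟩ := by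
  choose T Eo u hu using hexp
  let E := sigmaPsh (fun t : (Σ i, T i) => (Eo t.1 t.2).left)
  let e : E ⟶ F :=
    { app := fun Z => ↾ fun s => F.map (s.2 ≫ (Eo s.1.1 s.1.2).hom).op (a s.1.1)
      naturality := by
        intro Z Z' f
        ext s
        change F.map ((f.unop ≫ s.2) ≫ (Eo s.1.1 s.1.2).hom).op (a s.1.1) =
          F.map f.unop.op (F.map (s.2 ≫ (Eo s.1.1 s.1.2).hom).op (a s.1.1))
        rw [Category.assoc, psh_comp] }
  let evf : ∀ Z : K, (PB p e).obj (op Z) → B.obj (op Z) := fun Z s =>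
    ((u s.1.2.1.1 s.1.2.1.2).toFun (Over.homMk s.1.2.2 rfl :
      Over.mk (s.1.2.2 ≫ (Eo s.1.2.1.1 s.1.2.1.2).hom) ⟶ Eo s.1.2.1.1 s.1.2.1.2)
      ⟨s.1.1, s.2⟩).1
  have evf_eq : ∀ (i : I) (τ : T i) (W : Over (A i)) (k : W ⟶ Eo i τ) (x : X.obj (op W.left))
      (hx : p.app _ x = F.map W.hom.op (a i))
      (hx' : p.app _ x = e.app _ (⟨⟨i, τ⟩, k.left⟩ : E.obj (op W.left))),
      evf W.left ⟨(x, ⟨⟨i, τ⟩, k.left⟩), hx'⟩ = ((u i τ).toFun k ⟨x, hx⟩).1 := by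
    intro i τ W k x hx hx'
    let j : Over.mk (k.left ≫ (Eo i τ).hom) ⟶ W := Over.homMk (𝟙 _) (by simp)
    have h := congrArg Subtype.val ((u i τ).nat j k ⟨x, hx⟩)
    have h' : (Over.homMk k.left rfl : Over.mk (k.left ≫ (Eo i τ).hom) ⟶ Eo i τ) = j ≫ k := by
      ext
      exact (Category.id_comp _).symm
    have h3 : ((Res b (a i)).map j.op ((u i τ).toFun k ⟨x, hx⟩)).1 =
      ((u i τ).toFun k ⟨x, hx⟩).1 := psh_id B _
    refine Eq.trans ?_ (h.trans h3)
    change ((u i τ).toFun (Over.homMk k.left rfl : Over.mk (k.left ≫ (Eo i τ).hom) ⟶ Eo i τ)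
      ⟨x, _⟩).1 = _
    rw [h']
    congr 2
    apply Subtype.ext
    exact (psh_id X x).symm
  let ev : PB p e ⟶ B :=
    { app := fun Z => ↾ evf Z.unop
      naturality := by
        intro Z Z' f
        ext s
        obtain ⟨⟨x, ⟨⟨i, τ⟩, g⟩⟩, hs⟩ := s
        let k : Over.mk (g ≫ (Eo i τ).hom) ⟶ Eo i τ := Over.homMk g rfl
        let j : Over.mk (f.unop ≫ g ≫ (Eo i τ).hom) ⟶ Over.mk (g ≫ (Eo i τ).hom) :=
          Over.homMk f.unop rfl
        have h := congrArg Subtype.val ((u i τ).nat j k ⟨x, hs⟩)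
        refine Eq.trans ?_ h
        exact evf_eq i τ _ (j ≫ k) (X.map f x) _ _ }
  have key : ∀ (Y : Kᵒᵖ ⥤ Type v) (q : Y ⟶ F) (c : PB p q ⟶ B), c ≫ b = PBfst p q ≫ p →
      ∀ (Z : K) (y : Y.obj (op Z)), ∃! s : E.obj (op Z), e.app _ s = q.app _ y ∧
        ∀ (W : K) (g : W ⟶ Z) (x : X.obj (op W)) (h1 : p.app _ x = q.app _ (Y.map g.op y))
          (h2 : p.app _ x = e.app _ (E.map g.op s)),
          ev.app (op W) ⟨(x, E.map g.op s), h2⟩ = c.app (op W) ⟨(x, Y.map g.op y), h1⟩ := by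
    intro Y q c hc Z y
    obtain ⟨⟨i, z⟩, hz, hzu⟩ := ha Z (q.app _ y)
    dsimp only at hz
    have hy : ∀ {W : Over (A i)} (g : W ⟶ Over.mk z),
        q.app _ (Y.map g.left.op y) = F.map W.hom.op (a i) := by
      intro W g
      have h0 : ∀ (W : K) (g : W ⟶ Z), q.app _ (Y.map g.op y) = F.map (g ≫ z).op (a i) := by
        intro W g
        rw [psh_nat, ← hz, ← psh_comp]
      exact (h0 W.left g.left).trans (congrArg (fun k => F.map k.op (a i)) (Over.w g))
    let θ : CFam (Res p (a i)) (Res b (a i)) (Over.mk z) :=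
      { toFun := fun W g x => ⟨c.app (op W.left) ⟨(x.1, Y.map g.left.op y),
            x.2.trans (hy g).symm⟩, by
          refine (congrArg (fun k => k.app (op W.left) ⟨(x.1, Y.map g.left.op y),
            x.2.trans (hy g).symm⟩) hc).trans ?_
          exact x.2⟩
        nat := by
          intro W W' h g x
          apply Subtype.ext
          refine Eq.trans ?_ (psh_nat c h.left _)
          refine congrArg (c.app _) ?_
          apply Subtype.ext
          refine Prod.ext rfl ?_
          exact psh_comp Y h.left g.left y }
    obtain ⟨⟨τ, f⟩, hf, hfu⟩ := hu i (Over.mk z) θ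
    refine ⟨⟨⟨i, τ⟩, f.left⟩, ⟨?_, ?_⟩, ?_⟩
    · refine Eq.trans ?_ hz
      change F.map (f.left ≫ _).op _ = _
      rw [Over.w]
      rfl
    · intro W g x h1 h2
      let k : Over.mk (g ≫ z) ⟶ Over.mk z := Over.homMk g rfl
      have hx : p.app _ x = F.map (g ≫ z).op (a i) := h1.trans (hy k)
      refine (evf_eq i τ _ (k ≫ f) x hx h2).trans ?_
      have h3 := congrArg (fun t : CFam (Res p (a i)) (Res b (a i)) (Over.mk z) =>
        (t.toFun k ⟨x, hx⟩).1) hf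
      exact h3
    · rintro ⟨⟨i', τ'⟩, f'⟩ ⟨h1, h2⟩
      have h3 := hzu ⟨i', f' ≫ (Eo i' τ').hom⟩ h1
      obtain ⟨rfl, h4⟩ := Sigma.mk.inj_iff.1 h3
      have h4 := eq_of_heq h4
      have h5 := hfu ⟨τ', Over.homMk f' h4⟩ (by
        apply CFam.ext
        funext W k x
        apply Subtype.ext
        have h6 : p.app _ x.1 = e.app _ (E.map k.left.op (⟨⟨i', τ'⟩, f'⟩ : E.obj (op Z))) := by
          refine (x.2.trans (hy k).symm).trans ?_
          refine (psh_nat q k.left y).trans ?_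
          exact (congrArg (F.map k.left.op) h1.symm).trans (psh_nat e k.left _).symm
        refine Eq.trans ?_ (h2 W.left k.left x.1 (x.2.trans (hy k).symm) h6)
        exact (evf_eq i' τ' W (k ≫ Over.homMk f' h4) x.1 x.2 h6).symm)
      exact congrArg (fun p : Σ t, (Over.mk z ⟶ Eo i' t) =>
        (⟨⟨i', p.1⟩, p.2.left⟩ : Σ t : (Σ i, T i), (Z ⟶ (Eo t.1 t.2).left))) h5
  refine ⟨E, e, ev, multiRep_sigmaPsh _, ?_, ?_⟩
  · ext Z s
    obtain ⟨⟨x, ⟨⟨i, τ⟩, g⟩⟩, hs⟩ := s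
    exact ((u i τ).toFun (Over.homMk g rfl : Over.mk (g ≫ (Eo i τ).hom) ⟶ Eo i τ)
      ⟨x, hs⟩).2.trans hs.symm
  · intro Y q c hc
    choose s hs hsu using key Y q c hc
    refine ⟨{ app := fun Z => ↾ fun y => s Z.unop y, naturality := ?_ }, ⟨?_, ?_⟩, ?_⟩
    · intro Z Z' f
      ext y
      refine (hsu Z'.unop (Y.map f y) (E.map f (s Z.unop y)) ⟨?_, ?_⟩).symm
      · refine (psh_nat e f.unop _).trans ?_
        rw [(hs Z.unop y).1]
        exact (psh_nat q f.unop _).symm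
      · intro W g x h1 h2
        have h3 : Y.map g.op (Y.map f y) = Y.map (g ≫ f.unop).op y := (psh_comp Y g f.unop y).symm
        have h4 : E.map g.op (E.map f (s Z.unop y)) = E.map (g ≫ f.unop).op (s Z.unop y) :=
          (psh_comp E g f.unop _).symm
        simp only [h3, h4]
        apply (hs Z.unop y).2 W (g ≫ f.unop)
    · ext Z y
      exact (hs Z.unop y).1
    · intro Z x y h1 h2
      have h3 := (hs Z y).2 Z (𝟙 Z) x (by rw [psh_id]; exact h1) (by rw [psh_id]; exact h2)
      simp only [psh_id] at h3
      exact h3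
    · rintro h ⟨h1, h2⟩
      ext Z y
      refine hsu Z.unop y (h.app Z y) ⟨congrArg (fun k => k.app Z y) h1, ?_⟩
      intro W g x h3 h4
      have h5 : E.map g.op (h.app Z y) = h.app _ (Y.map g.op y) := (psh_nat h g y).symm
      simp only [h5]
      apply h2

end Exp

section CartClosed

open MonoidalCategory CartesianMonoidalCategory

variable {C : Type u} [Category.{v} C]

/-- Elementary formulation of being a binary product. -/
def IsProd {X Y Q : C} (p₁ : Q ⟶ X) (p₂ : Q ⟶ Y) : Prop :=
  ∀ (W : C) (f : W ⟶ X) (g : W ⟶ Y), ∃! h : W ⟶ Q, h ≫ p₁ = f ∧ h ≫ p₂ = g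

theorem IsProd.nonempty_isLimit {X Y Q : C} {p₁ : Q ⟶ X} {p₂ : Q ⟶ Y} (h : IsProd p₁ p₂) :
    Nonempty (IsLimit (BinaryFan.mk p₁ p₂)) := by
  choose l hl hlu using h
  exact ⟨BinaryFan.IsLimit.mk _ (fun {W} f g => l W f g) (fun f g => (hl _ f g).1)
    (fun f g => (hl _ f g).2) (fun f g m h1 h2 => hlu _ f g m ⟨h1, h2⟩)⟩

theorem cartesianClosedP_of (T : C) (hT : IsTerminal T) (P : C → C → C)
    (π₁ : ∀ X Y, P X Y ⟶ X) (π₂ : ∀ X Y, P X Y ⟶ Y) (hP : ∀ X Y, IsProd (π₁ X Y) (π₂ X Y))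
    (hexp : ∀ X B : C, ∃ (E : C) (ev : P X E ⟶ B), ∀ (Y : C) (c : P X Y ⟶ B),
      ∃! h : Y ⟶ E, ∀ k : P X Y ⟶ P X E, k ≫ π₁ X E = π₁ X Y → k ≫ π₂ X E = π₂ X Y ≫ h →
        k ≫ ev = c) : CartesianClosedP C := by
  let hc : CartesianMonoidalCategory C := .ofChosenFiniteProducts
    ⟨asEmptyCone T, hT⟩ (fun X Y => ⟨BinaryFan.mk (π₁ X Y) (π₂ X Y),
      (hP X Y).nonempty_isLimit.some⟩)
  refine ⟨hc, ⟨?_⟩⟩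
  have hexp' : ∀ X B : C, ∃ (E : C) (ev : X ⊗ E ⟶ B), ∀ (Y : C) (c : X ⊗ Y ⟶ B),
      ∃! h : Y ⟶ E, X ◁ h ≫ ev = c := by
    intro X B
    obtain ⟨E, ev, h⟩ := hexp X B
    refine ⟨E, ev, fun Y c => ?_⟩
    have key : ∀ g : Y ⟶ E, (X ◁ g ≫ ev = c ↔ ∀ k : P X Y ⟶ P X E, k ≫ π₁ X E = π₁ X Y →
        k ≫ π₂ X E = π₂ X Y ≫ g → k ≫ ev = c) := by
      intro g
      have e1 : X ◁ g ≫ fst X E = fst X Y := whiskerLeft_fst X g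
      have e2 : X ◁ g ≫ snd X E = snd X Y ≫ g := whiskerLeft_snd X g
      constructor
      · intro hg k hk1 hk2
        have : k = X ◁ g := (hP X E _ _ _).unique ⟨hk1, hk2⟩ ⟨e1, e2⟩
        rw [this]
        exact hg
      · intro H
        exact H (X ◁ g) e1 e2
    obtain ⟨g, hg, hgu⟩ := h Y c
    exact ⟨g, (key g).2 hg, fun g' hg' => hgu g' ((key g').1 hg')⟩
  choose E ev hev using hexp'
  choose cur hcur hcuru using hev
  exact
    { closed := fun X =>
        { rightAdj := Adjunction.rightAdjointOfEquiv (F := tensorLeft X) (G_obj := E X)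
            (fun Y B =>
              { toFun := fun c => cur X B Y c
                invFun := fun g => X ◁ g ≫ ev X B
                left_inv := fun c => hcur X B Y c
                right_inv := fun g => (hcuru X B Y _ g rfl).symm })
            (fun Y' Y B f g => by
              refine (hcuru X B _ _ _ ?_).symm
              change X ◁ (f ≫ cur X B Y g) ≫ ev X B = X ◁ f ≫ g
              rw [MonoidalCategory.whiskerLeft_comp, Category.assoc]
              exact congrArg _ (hcur X B Y g))
          adj := Adjunction.adjunctionOfEquivRight _ _ } }

theorem CartesianClosedP.exists_exp (h : CartesianClosedP C) (X B : C) :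
    ∃ (E : C) (φ : ∀ {Y Q : C} (p₁ : Q ⟶ X) (p₂ : Q ⟶ Y), IsProd p₁ p₂ → (Q ⟶ B) → (Y ⟶ E)),
      (∀ {Y Q : C} (p₁ : Q ⟶ X) (p₂ : Q ⟶ Y) (hp : IsProd p₁ p₂),
        Function.Bijective (φ p₁ p₂ hp)) ∧
      ∀ {Y Q Y' Q' : C} (p₁ : Q ⟶ X) (p₂ : Q ⟶ Y) (hp : IsProd p₁ p₂)
        (p₁' : Q' ⟶ X) (p₂' : Q' ⟶ Y') (hp' : IsProd p₁' p₂') (k : Y' ⟶ Y) (k' : Q' ⟶ Q)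
        (_ : k' ≫ p₁ = p₁') (_ : k' ≫ p₂ = p₂' ≫ k) (c : Q ⟶ B),
        φ p₁' p₂' hp' (k' ≫ c) = k ≫ φ p₁ p₂ hp c := by
  obtain ⟨hc, ⟨hm⟩⟩ := h
  refine ⟨(ihom X).obj B, fun {Y Q} p₁ p₂ hp c =>
    MonoidalClosed.curry ((hp (X ⊗ Y) (fst X Y) (snd X Y)).choose ≫ c), ?_, ?_⟩
  · intro Y Q p₁ p₂ hp
    obtain ⟨⟨h1, h2⟩, -⟩ := (hp (X ⊗ Y) (fst X Y) (snd X Y)).choose_spec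
    set i := (hp (X ⊗ Y) (fst X Y) (snd X Y)).choose
    have hi : lift p₁ p₂ ≫ i = 𝟙 Q := (hp Q p₁ p₂).unique
      ⟨by rw [Category.assoc, h1, lift_fst], by rw [Category.assoc, h2, lift_snd]⟩
      ⟨Category.id_comp _, Category.id_comp _⟩
    have hi' : i ≫ lift p₁ p₂ = 𝟙 _ := by
      apply CartesianMonoidalCategory.hom_ext <;> simp [h1, h2]
    constructor
    · intro c c' hcc
      have := MonoidalClosed.curry_injective hcc
      have e : ∀ t : Q ⟶ B, lift p₁ p₂ ≫ i ≫ t = t := by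
        intro t
        rw [← Category.assoc, hi, Category.id_comp]
      exact (e c).symm.trans ((congrArg (fun t => lift p₁ p₂ ≫ t) this).trans (e c'))
    · intro g
      refine ⟨lift p₁ p₂ ≫ MonoidalClosed.uncurry g, ?_⟩
      dsimp only
      rw [← Category.assoc, hi', Category.id_comp, MonoidalClosed.curry_uncurry]
  · intro Y Q Y' Q' p₁ p₂ hp p₁' p₂' hp' k k' hk1 hk2 c
    obtain ⟨⟨h1, h2⟩, -⟩ := (hp (X ⊗ Y) (fst X Y) (snd X Y)).choose_spec
    obtain ⟨⟨h1', h2'⟩, -⟩ := (hp' (X ⊗ Y') (fst X Y') (snd X Y')).choose_spec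
    dsimp only
    set i := (hp (X ⊗ Y) (fst X Y) (snd X Y)).choose
    set i' := (hp' (X ⊗ Y') (fst X Y') (snd X Y')).choose
    rw [← MonoidalClosed.curry_natural_left, ← Category.assoc, ← Category.assoc]
    congr 2
    refine (hp _ (fst X Y') (snd X Y' ≫ k)).unique ⟨?_, ?_⟩ ⟨?_, ?_⟩
    · rw [Category.assoc, hk1, h1']
    · rw [Category.assoc, hk2, ← Category.assoc, h2']
    · rw [Category.assoc, h1, whiskerLeft_fst]
    · rw [Category.assoc, h2, whiskerLeft_snd]

end CartClosed

section Backward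

variable {K : Type u} [Category.{v} K]

/-- The underlying presheaf morphism of an object over `F`. -/
def pr {F : SigmaCompletion K} (X : Over F) : X.left.obj ⟶ F.obj := X.hom.hom

theorem sc_multiRep (F : SigmaCompletion K) : MultiRep F.obj :=
  (isCoproductOfRepresentables_iff _).1 F.property

/-- Build an object over `F`. -/
def ov {F : SigmaCompletion K} {X : Kᵒᵖ ⥤ Type v} (hX : MultiRep X) (p : X ⟶ F.obj) : Over F :=
  Over.mk (Y := (⟨X, (isCoproductOfRepresentables_iff _).2 hX⟩ : SigmaCompletion K))
    (ObjectProperty.homMk p)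

/-- Build a morphism over `F`. -/
def ovHom {F : SigmaCompletion K} {X Y : Over F} (f : X.left.obj ⟶ Y.left.obj)
    (h : f ≫ pr Y = pr X) : X ⟶ Y :=
  Over.homMk (ObjectProperty.homMk f) (ObjectProperty.hom_ext _ h)

theorem ovHom_w {F : SigmaCompletion K} {X Y : Over F} (f : X ⟶ Y) :
    f.left.hom ≫ pr Y = pr X :=
  congrArg (fun k => k.hom) (Over.w f)

theorem ov_ext {F : SigmaCompletion K} {X Y : Over F} {f g : X ⟶ Y}
    (h : f.left.hom = g.left.hom) : f = g := by
  ext1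
  exact ObjectProperty.hom_ext _ h

theorem backward [HasLimits K] (h : LocallyCartesianMultiClosed K) :
    LocallyCartesianClosedP (SigmaCompletion K) := by
  intro F
  have : ∀ A : K, HasProducts.{v} (Over A) := fun A =>
    Over.ConstructProducts.over_products_of_widePullbacks
  have : ∀ A : K, HasBinaryProducts (Over A) := fun A => by
    obtain ⟨hf, -⟩ := h A
    infer_instance
  have hPB : ∀ X Y : Over F, MultiRep (PB (pr X) (pr Y)) := fun X Y =>
    multiRep_PB _ _ (sc_multiRep F) (sc_multiRep _) (sc_multiRep _)
  refine cartesianClosedP_of (Over.mk (𝟙 F)) Over.mkIdTerminal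
    (fun X Y => ov (hPB X Y) (PBfst (pr X) (pr Y) ≫ pr X))
    (fun X Y => ovHom (PBfst (pr X) (pr Y)) rfl)
    (fun X Y => ovHom (PBsnd (pr X) (pr Y)) (PB_cond _ _).symm) ?_ ?_
  · intro X Y W f g
    refine ⟨ovHom (PBlift (pr X) (pr Y) f.left.hom g.left.hom
      ((ovHom_w f).trans (ovHom_w g).symm)) (ovHom_w f), ⟨ov_ext rfl, ov_ext rfl⟩, ?_⟩
    rintro k ⟨rfl, rfl⟩
    exact ov_ext rfl
  · intro X B
    obtain ⟨I, A, a, ha⟩ := sc_multiRep F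
    obtain ⟨E, e, ev, hE, hev, huniv⟩ := exists_exp (pr X) (pr B) ha (fun i => by
      obtain ⟨hf, hC⟩ := h (A i)
      exact multiRep_cfam hC (multiRep_res _ (sc_multiRep _) ha i)
        (multiRep_res _ (sc_multiRep _) ha i))
    refine ⟨ov hE e, ovHom ev hev, fun Y c => ?_⟩
    obtain ⟨g, ⟨hg1, hg2⟩, hgu⟩ := huniv Y.left.obj (pr Y) c.left.hom (ovHom_w c)
    refine ⟨ovHom g hg1, ?_, ?_⟩
    · intro k hk1 hk2
      apply ov_ext
      have hk1' : k.left.hom ≫ PBfst (pr X) e = PBfst (pr X) (pr Y) :=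
        congrArg (fun t => t.left.hom) hk1
      have hk2' : k.left.hom ≫ PBsnd (pr X) e = PBsnd (pr X) (pr Y) ≫ g :=
        congrArg (fun t => t.left.hom) hk2
      ext ⟨Z⟩ ⟨⟨x, y⟩, hxy⟩
      have h2 : (pr X).app (op Z) x = e.app (op Z) (g.app (op Z) y) :=
        hxy.trans (congrArg (fun t => t.app (op Z) y) hg1).symm
      refine Eq.trans ?_ (hg2 Z x y hxy h2)
      have : k.left.hom.app (op Z) ⟨(x, y), hxy⟩ = ⟨(x, g.app (op Z) y), h2⟩ := by
        apply Subtype.ext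
        exact Prod.ext (congrArg (fun t => t.app (op Z) ⟨(x, y), hxy⟩) hk1')
          (congrArg (fun t => t.app (op Z) ⟨(x, y), hxy⟩) hk2')
      exact congrArg (ev.app (op Z)) this
    · intro g' hg'
      apply ov_ext
      refine hgu g'.left.hom ⟨ovHom_w g', ?_⟩
      intro Z x y h1 h2
      have w := ovHom_w g'
      have := hg' (ovHom (PBlift (pr X) e (PBfst (pr X) (pr Y))
        (PBsnd (pr X) (pr Y) ≫ g'.left.hom)
        ((PB_cond _ _).trans (congrArg (fun t => PBsnd (pr X) (pr Y) ≫ t) w.symm))) rfl)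
        (ov_ext rfl) (ov_ext rfl)
      have := congrArg (fun t => t.left.hom.app (op Z) ⟨(x, y), h1⟩) this
      exact this

end Backward

section Forward

variable {K : Type u} [Category.{v} K]

theorem yoneda_uniq (A : K) (Z : K) (z : (yoneda.obj A).obj (op Z)) :
    ∃! p : Σ _ : PUnit.{v + 1}, (Z ⟶ A), (yoneda.obj A).map p.2.op (𝟙 A) = z := by
  refine ⟨⟨PUnit.unit, z⟩, Category.comp_id (X := Z) (Y := A) z, ?_⟩
  rintro ⟨⟨⟩, f⟩ hf
  have hf : f ≫ 𝟙 A = z := hf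
  rw [Category.comp_id] at hf
  rw [hf]

theorem multiRep_yoneda (A : K) : MultiRep (yoneda.obj A) :=
  ⟨PUnit, fun _ => A, fun _ => 𝟙 A, yoneda_uniq A⟩

/-- The representable object of the completion. -/
def yS (A : K) : SigmaCompletion K :=
  ⟨yoneda.obj A, (isCoproductOfRepresentables_iff _).2 (multiRep_yoneda A)⟩

/-- The embedding of slices. -/
def Ph {A : K} (X : Over A) : Over (yS A) :=
  ov (multiRep_yoneda X.left) (yoneda.map X.hom)

/-- The embedding of slices on morphisms. -/
def PhHom {A : K} {X Y : Over A} (f : X ⟶ Y) : Ph X ⟶ Ph Y :=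
  ovHom (X := Ph X) (Y := Ph Y) (yoneda.map f.left)
    ((yoneda.map_comp f.left Y.hom).symm.trans (congrArg yoneda.map (Over.w f)))

theorem PhHom_comp {A : K} {X Y Z : Over A} (f : X ⟶ Y) (g : Y ⟶ Z) :
    PhHom (f ≫ g) = PhHom f ≫ PhHom g :=
  ov_ext (yoneda.map_comp f.left g.left)

theorem PhHom_bij {A : K} (X Y : Over A) :
    Function.Bijective (PhHom : (X ⟶ Y) → (Ph X ⟶ Ph Y)) := by
  constructor
  · intro f g h
    ext
    exact yoneda.map_injective (congrArg (fun t => t.left.hom) h)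
  · intro g
    let g' : yoneda.obj X.left ⟶ yoneda.obj Y.left := g.left.hom
    have h : yoneda.map (yoneda.preimage g') = g' := yoneda.map_preimage g'
    have w : g' ≫ yoneda.map Y.hom = yoneda.map X.hom := ovHom_w g
    refine ⟨Over.homMk (yoneda.preimage g') (yoneda.map_injective ?_), ov_ext h⟩
    rw [yoneda.map_comp, h]
    exact w

/-- Yoneda over a slice. -/
def elt {A : K} (X : Over A) (E : Over (yS A)) (g : Ph X ⟶ E) :
    (Res (F := yoneda.obj A) (pr E) (𝟙 A)).obj (op X) :=
  ⟨g.left.hom.app (op X.left) (𝟙 X.left), by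
    have h : (pr E).app (op X.left) (g.left.hom.app (op X.left) (𝟙 X.left)) =
        𝟙 X.left ≫ X.hom :=
      congrArg (fun t => t.app (op X.left) (𝟙 X.left)) (ovHom_w g)
    refine h.trans ?_
    change 𝟙 X.left ≫ X.hom = X.hom ≫ 𝟙 A
    rw [Category.id_comp, Category.comp_id]⟩

theorem elt_bij {A : K} (X : Over A) (E : Over (yS A)) :
    Function.Bijective (elt X E) := by
  constructor
  · intro g g' h
    apply ov_ext
    exact yonedaEquiv.injective (congrArg Subtype.val h)
  · rintro ⟨x, hx⟩
    have hx : (pr E).app (op X.left) x = X.hom := by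
      refine hx.trans ?_
      change X.hom ≫ 𝟙 A = X.hom
      rw [Category.comp_id]
    let k : yoneda.obj X.left ⟶ E.left.obj := yonedaEquiv.symm x
    have hk : yonedaEquiv k = x := Equiv.apply_symm_apply _ _
    refine ⟨ovHom (X := Ph X) k ?_, Subtype.ext hk⟩
    apply yonedaEquiv.injective
    refine (congrArg ((pr E).app (op X.left)) hk).trans (hx.trans ?_)
    change X.hom = 𝟙 _ ≫ X.hom
    rw [Category.id_comp]

theorem elt_nat {A : K} {X Y : Over A} (E : Over (yS A)) (g : Ph Y ⟶ E) (f : X ⟶ Y) :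
    elt X E (PhHom f ≫ g) = (Res (F := yoneda.obj A) (pr E) (𝟙 A)).map f.op (elt Y E g) := by
  apply Subtype.ext
  change g.left.hom.app (op X.left) (𝟙 X.left ≫ f.left) =
    E.left.obj.map f.left.op (g.left.hom.app (op Y.left) (𝟙 Y.left))
  refine Eq.trans ?_ (psh_nat g.left.hom f.left (𝟙 Y.left))
  refine congrArg (g.left.hom.app (op X.left)) ?_
  change 𝟙 X.left ≫ f.left = f.left ≫ 𝟙 _
  rw [Category.id_comp, Category.comp_id]

theorem over_prod_uniq {A : K} [HasBinaryProducts (Over A)] (X Y : Over A) (Z : K)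
    (a : Z ⟶ X.left) (b : Z ⟶ Y.left) (h : a ≫ X.hom = b ≫ Y.hom) :
    ∃! k : Z ⟶ (X ⨯ Y).left, k ≫ (prod.fst : X ⨯ Y ⟶ X).left = a ∧
      k ≫ (prod.snd : X ⨯ Y ⟶ Y).left = b := by
  let f : Over.mk (a ≫ X.hom) ⟶ X := Over.homMk a rfl
  let g : Over.mk (a ≫ X.hom) ⟶ Y := Over.homMk b h.symm
  refine ⟨(prod.lift f g).left, ⟨?_, ?_⟩, ?_⟩
  · exact congrArg (fun t => t.left) (prod.lift_fst f g)
  · exact congrArg (fun t => t.left) (prod.lift_snd f g)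
  · rintro k ⟨h1, h2⟩
    let k' : Over.mk (a ≫ X.hom) ⟶ X ⨯ Y := Over.homMk k (by
      change k ≫ (X ⨯ Y).hom = a ≫ X.hom
      rw [← Over.w (prod.fst : X ⨯ Y ⟶ X), ← Category.assoc, h1])
    have : k' = prod.lift f g := by
      ext
      · exact h1.trans (congrArg (fun t => t.left) (prod.lift_fst f g)).symm
      · exact h2.trans (congrArg (fun t => t.left) (prod.lift_snd f g)).symm
    exact congrArg (fun t => t.left) this

theorem isProd_Ph {A : K} [HasBinaryProducts (Over A)] (X Y : Over A) :
    IsProd (PhHom (prod.fst : X ⨯ Y ⟶ X)) (PhHom (prod.snd : X ⨯ Y ⟶ Y)) := by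
  intro W f g
  have hfg : ∀ (Z : K) (w : W.left.obj.obj (op Z)),
      ∃! k : Z ⟶ (X ⨯ Y).left, k ≫ (prod.fst : X ⨯ Y ⟶ X).left = f.left.hom.app (op Z) w ∧
        k ≫ (prod.snd : X ⨯ Y ⟶ Y).left = g.left.hom.app (op Z) w := by
    intro Z w
    refine over_prod_uniq X Y Z _ _ ?_
    exact congrArg (fun t => t.app (op Z) w) ((ovHom_w f).trans (ovHom_w g).symm)
  choose l hl hlu using hfg
  let l' : W.left.obj ⟶ yoneda.obj (X ⨯ Y).left :=
    { app := fun Z => ↾ fun w => l Z.unop w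
      naturality := by
        rintro ⟨Z⟩ ⟨Z'⟩ k
        ext w
        refine (hlu Z' (W.left.obj.map k w) (k.unop ≫ l Z w) ⟨?_, ?_⟩).symm
        · rw [Category.assoc, (hl Z w).1]
          exact (psh_nat f.left.hom k.unop w).symm
        · rw [Category.assoc, (hl Z w).2]
          exact (psh_nat g.left.hom k.unop w).symm }
  have hl1 : l' ≫ yoneda.map (prod.fst : X ⨯ Y ⟶ X).left = f.left.hom := by
    ext ⟨Z⟩ w
    exact (hl Z w).1
  have hl2 : l' ≫ yoneda.map (prod.snd : X ⨯ Y ⟶ Y).left = g.left.hom := by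
    ext ⟨Z⟩ w
    exact (hl Z w).2
  refine ⟨ovHom (Y := Ph (X ⨯ Y)) l' ?_, ⟨ov_ext hl1, ov_ext hl2⟩, ?_⟩
  · refine Eq.trans ?_ (ovHom_w f)
    refine Eq.trans ?_ (congrArg (fun t => t ≫ pr (Ph X)) hl1)
    refine Eq.trans ?_ (Category.assoc _ _ _).symm
    exact congrArg (fun t => l' ≫ t) (ovHom_w (PhHom (prod.fst : X ⨯ Y ⟶ X))).symm
  · rintro k ⟨rfl, rfl⟩
    apply ov_ext
    ext ⟨Z⟩ w
    exact hlu Z w _ ⟨rfl, rfl⟩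

theorem forward [HasLimits K] (h : LocallyCartesianClosedP (SigmaCompletion K)) :
    LocallyCartesianMultiClosed K := by
  intro A
  have hf : HasFiniteProducts (Over A) := by
    have : HasFiniteLimits (Over A) := inferInstance
    infer_instance
  refine ⟨hf, fun X B => ?_⟩
  obtain ⟨E, φ, hbij, hnat⟩ := (h (yS A)).exists_exp (Ph X) (Ph B)
  let m : ∀ Z : Over A, (X ⨯ Z ⟶ B) → (Res (F := yoneda.obj A) (pr E) (𝟙 A)).obj (op Z) :=
    fun Z c => elt Z E (φ _ _ (isProd_Ph X Z) (PhHom c))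
  have hm : ∀ Z, Function.Bijective (m Z) := fun Z =>
    (elt_bij Z E).comp ((hbij _ _ (isProd_Ph X Z)).comp (PhHom_bij _ _))
  have hmn : ∀ {Z Z' : Over A} (f : Z' ⟶ Z) (c : X ⨯ Z ⟶ B),
      m Z' (prod.map (𝟙 X) f ≫ c) =
        (Res (F := yoneda.obj A) (pr E) (𝟙 A)).map f.op (m Z c) := by
    intro Z Z' f c
    refine Eq.trans ?_ (elt_nat E _ f)
    refine congrArg (elt Z' E) ?_
    rw [PhHom_comp]
    refine hnat _ _ _ _ _ _ _ _ ?_ ?_ _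
    · rw [← PhHom_comp, prod.map_fst, Category.comp_id]
    · rw [← PhHom_comp, ← PhHom_comp, prod.map_snd]
  have hR : MultiRep (Res (F := yoneda.obj A) (pr E) (𝟙 A)) :=
    multiRep_res (F := yoneda.obj A) (pr E) (sc_multiRep _) (A := fun _ : PUnit.{v + 1} => A)
      (a := fun _ => 𝟙 A) (yoneda_uniq A) PUnit.unit
  obtain ⟨I, Eo, e, he⟩ := hR
  choose ev hev using fun i => (hm (Eo i)).2 (e i)
  refine ⟨I, Eo, ev, fun Z c => ?_⟩
  have key : ∀ q : Σ i, (Z ⟶ Eo i), (prod.map (𝟙 X) q.2 ≫ ev q.1 = c ↔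
      (Res (F := yoneda.obj A) (pr E) (𝟙 A)).map q.2.op (e q.1) = m Z c) := by
    intro q
    rw [← (hm Z).1.eq_iff, hmn, hev]
  obtain ⟨p, hp, hpu⟩ := he Z (m Z c)
  exact ⟨p, (key p).2 hp, fun q hq => hpu q ((key q).1 hq)⟩

end Forward

/-- Theorem 2.12: for a complete category `𝒦`, the completion `Σ𝒦` is
locally cartesian closed iff `𝒦` is locally cartesian multi-closed. -/
theorem sigmaCompletion_locallyCartesianClosed_iff (K : Type u) [Category.{v} K]
    [HasLimits K] :
    LocallyCartesianClosedP (SigmaCompletion K) ↔ LocallyCartesianMultiClosed K := by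
  exact ⟨forward, backward⟩
end FreeCompletions
end

section
/- Let 𝒦 be a complete category with a strict initial object. Then the free coproduct completion Σ𝒦 is cartesian closed if and only if 𝒦 is cartesian closed, and Σ𝒦 is locally cartesian closed if and only if 𝒦 is locally cartesian closed. -/
/- Common definitions for formalizing "How nice are free completions of categories?"
   by Adámek and Rosický. -/

open CategoryTheory CategoryTheory.Limits

universe w w₁ w₂ v₁ u₁

namespace FreeCompletions

universe v u

universe v' u'

section Helpers

open MonoidalCategory CartesianMonoidalCategory

/-- Transfer along an equivalence. -/
theorem CartesianClosedP.closed_of_equiv {C : Type u} [Category.{v} C] [CartesianMonoidalCategory C]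
    {D : Type u'} [Category.{v'} D] (e : D ≌ C)
    (h : CartesianClosedP D) : Nonempty (MonoidalClosed C) := by
  obtain ⟨hD, ⟨hc⟩⟩ := h
  exact ⟨CategoryTheory.cartesianClosedOfEquiv e⟩

theorem CartesianClosedP.of_equiv {C : Type u} [Category.{v} C]
    {D : Type u'} [Category.{v'} D] (e : D ≌ C)
    (h : CartesianClosedP D) : CartesianClosedP C := by
  have : HasFiniteProducts D := by
    obtain ⟨hD, _⟩ := h
    infer_instance
  have : HasFiniteProducts C :=
    ⟨fun n => Adjunction.hasLimitsOfShape_of_equivalence e.inverse⟩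
  let _ := CartesianMonoidalCategory.ofHasFiniteProducts (C := C)
  exact ⟨inferInstance, CartesianClosedP.closed_of_equiv e h⟩

/-- Elementary form of cartesian closedness relative to chosen products. -/
theorem ccp_iff {C : Type u} [Category.{v} C] [CartesianMonoidalCategory C] :
    CartesianClosedP C ↔ ∀ A B : C, ∃ (E : C) (ev : A ⊗ E ⟶ B),
      ∀ (X : C) (f : A ⊗ X ⟶ B), ∃! g : X ⟶ E, A ◁ g ≫ ev = f := by
  constructor
  · intro h A B
    obtain ⟨hc⟩ := CartesianClosedP.closed_of_equiv (CategoryTheory.Equivalence.refl (C := C)) h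
    refine ⟨(ihom A).obj B, (ihom.ev A).app B, fun X f => ⟨MonoidalClosed.curry f, ?_, ?_⟩⟩
    · exact MonoidalClosed.whiskerLeft_curry_ihom_ev_app _ _ _
    · intro g hg
      try dsimp only at hg
      rw [← hg, MonoidalClosed.eq_curry_iff, MonoidalClosed.uncurry_eq]
  · intro h
    refine ⟨inferInstance, ?_⟩
    choose E ev hE using h
    choose cur hcur huniq using hE
    let eqv (A X B : C) : ((tensorLeft A).obj X ⟶ B) ≃ (X ⟶ E A B) :=
      { toFun := fun f => cur A B X f
        invFun := fun g => A ◁ g ≫ ev A B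
        left_inv := fun f => hcur A B X f
        right_inv := fun g => (huniq A B X _ g rfl).symm }
    have he : ∀ (A X' X Y : C) (f : X' ⟶ X) (g : (tensorLeft A).obj X ⟶ Y),
        eqv A X' Y ((tensorLeft A).map f ≫ g) = f ≫ eqv A X Y g := by
      intro A X' X Y f g
      symm
      apply huniq
      simp only [MonoidalCategory.whiskerLeft_comp, Category.assoc]
      congr 1
      exact hcur A Y X g
    exact ⟨⟨fun A => ⟨_, Adjunction.adjunctionOfEquivRight (eqv A) (he A)⟩⟩⟩

open FormalCoproduct in
/-- Explicit cartesian structure on formal coproducts. -/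
noncomputable abbrev fcCMC (K : Type u) [Category.{v} K] [CartesianMonoidalCategory K] :
    CartesianMonoidalCategory (FormalCoproduct.{w} K) :=
  .ofChosenFiniteProducts
    ⟨asEmptyCone ((incl K).obj (𝟙_ K)), isTerminalIncl _ isTerminalTensorUnit⟩
    (fun A B =>
      ⟨BinaryFan.mk (P := ⟨A.I × B.I, fun p => A.obj p.1 ⊗ B.obj p.2⟩)
        ⟨Prod.fst, fun p => fst _ _⟩ ⟨Prod.snd, fun p => snd _ _⟩,
      BinaryFan.IsLimit.mk _
        (fun f g => ⟨fun t => (f.f t, g.f t), fun t => lift (f.φ t) (g.φ t)⟩)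
        (fun f g => by
          refine hom_ext rfl fun i => ?_
          simp)
        (fun f g => by
          refine hom_ext rfl fun i => ?_
          simp)
        (fun f g m hf hg => by
          subst hf hg
          refine hom_ext rfl fun i => ?_
          simp only [eqToHom_refl, Category.comp_id]
          apply CartesianMonoidalCategory.hom_ext
          · simp
          · simp)⟩)

section
variable {K : Type u} [Category.{v} K] [CartesianMonoidalCategory K]

open FormalCoproduct

theorem fc_whiskerLeft (A : FormalCoproduct.{w} K) {X Y : FormalCoproduct.{w} K} (g : X ⟶ Y) :
    letI := fcCMC.{w} K
    A ◁ g = (Hom.mk (X := ⟨A.I × X.I, fun p => A.obj p.1 ⊗ X.obj p.2⟩)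
      (Y := ⟨A.I × Y.I, fun p => A.obj p.1 ⊗ Y.obj p.2⟩)
      (fun p => (p.1, g.f p.2)) (fun p => A.obj p.1 ◁ g.φ p.2)) := by
  let _ := fcCMC.{w} K
  apply CartesianMonoidalCategory.hom_ext
  · rw [whiskerLeft_fst]
    refine hom_ext rfl fun i => ?_
    simp only [eqToHom_refl, Category.comp_id]
    exact (whiskerLeft_fst _ _).symm
  · rw [whiskerLeft_snd]
    refine hom_ext rfl fun i => ?_
    simp only [eqToHom_refl, Category.comp_id]
    exact (whiskerLeft_snd _ _).symm

theorem fc_ccp [HasProducts.{w} K] (h : CartesianClosedP K) :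
    CartesianClosedP (FormalCoproduct.{w} K) := by
  let _ := fcCMC.{w} K
  rw [ccp_iff] at h ⊢
  choose E ev hE using h
  intro A B
  let EE : FormalCoproduct.{w} K :=
    ⟨A.I → B.I, fun φ => ∏ᶜ fun i => E (A.obj i) (B.obj (φ i))⟩
  let EV : A ⊗ EE ⟶ B :=
    Hom.mk (X := ⟨A.I × EE.I, fun p => A.obj p.1 ⊗ EE.obj p.2⟩) (fun p => p.2 p.1)
      (fun p => A.obj p.1 ◁ Pi.π (fun i => E (A.obj i) (B.obj (p.2 i))) p.1 ≫ ev _ _)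
  refine ⟨EE, EV, fun X f => ?_⟩
  change Hom ⟨A.I × X.I, fun p => A.obj p.1 ⊗ X.obj p.2⟩ B at f
  choose cur hcur huniq using hE
  refine ⟨⟨fun x i => f.f (i, x), fun x => Pi.lift fun i => cur _ _ _ (f.φ (i, x))⟩, ?_, ?_⟩
  · dsimp only
    rw [fc_whiskerLeft]
    refine hom_ext rfl fun p => ?_
    simp only [eqToHom_refl, Category.comp_id]
    refine Eq.trans ?_ (hcur _ _ _ (f.φ p))
    change _ ◁ _ ≫ _ ◁ _ ≫ _ = _
    rw [← whiskerLeft_comp_assoc, Pi.lift_π]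
    rfl
  · intro g hg
    rw [fc_whiskerLeft] at hg
    subst hg
    refine hom_ext rfl fun x => ?_
    simp only [eqToHom_refl, Category.comp_id]
    apply Pi.hom_ext
    intro i
    refine Eq.trans ?_ (Pi.lift_π (f := fun i => E (A.obj i) (B.obj (g.f x i))) _ i).symm
    apply huniq
    change _ = _ ◁ _ ≫ _ ◁ _ ≫ _
    rw [← whiskerLeft_comp_assoc]

theorem ccp_of_fc [HasInitial K] [HasStrictInitialObjects K]
    (h : CartesianClosedP (FormalCoproduct.{w} K)) : CartesianClosedP K := by
  let _ := fcCMC.{w} K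
  rw [ccp_iff] at h ⊢
  intro A B
  obtain ⟨E, ev, hE⟩ := h ((incl K).obj A) ((incl K).obj B)
  change Hom ⟨PUnit × E.I, fun p => A ⊗ E.obj p.2⟩ ⟨PUnit, fun _ => B⟩ at ev
  -- homs out of representables
  have key : ∀ (X : K) (f : A ⊗ X ⟶ B), ∃! p : Σ t : E.I, X ⟶ E.obj t,
      A ◁ p.2 ≫ ev.φ (PUnit.unit, p.1) = f := by
    intro X f
    let F : (incl K).obj A ⊗ (incl K).obj X ⟶ (incl K).obj B :=
      Hom.mk (X := ⟨PUnit × PUnit, fun p => A ⊗ X⟩) (Y := ⟨PUnit, fun _ => B⟩)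
        (fun _ => PUnit.unit) (fun _ => f)
    obtain ⟨g, hg, hu⟩ := hE _ F
    rw [fc_whiskerLeft] at hg
    refine ⟨⟨g.f PUnit.unit, g.φ PUnit.unit⟩, ?_, ?_⟩
    · obtain ⟨h1, h2⟩ := (hom_ext_iff' _ _).1 hg (PUnit.unit, PUnit.unit)
      simp only [eqToHom_refl, Category.comp_id] at h2
      exact h2
    · rintro ⟨t, m⟩ hm
      have := hu (Hom.fromIncl t m) (by
        beta_reduce
        rw [fc_whiskerLeft]
        refine hom_ext rfl fun p => ?_
        simp only [eqToHom_refl, Category.comp_id]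
        exact hm)
      subst this
      rfl
  have hini : IsInitial (A ⊗ ⊥_ K) := by
    have := HasStrictInitialObjects.out (snd A (⊥_ K)) initialIsInitial
    exact initialIsInitial.ofIso (asIso (snd A (⊥_ K))).symm
  obtain ⟨⟨t₀, m₀⟩, h₀, u₀⟩ := key (⊥_ K) (hini.to B)
  have ht : ∀ t, t = t₀ := fun t =>
    congrArg Sigma.fst (u₀ ⟨t, initial.to _⟩ (hini.hom_ext _ _))
  refine ⟨E.obj t₀, ev.φ (PUnit.unit, t₀), fun X f => ?_⟩
  obtain ⟨⟨t, m⟩, hm, um⟩ := key X f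
  obtain rfl := ht t
  refine ⟨m, hm, fun m' hm' => ?_⟩
  have := um ⟨t, m'⟩ hm'
  simpa using this

end

/-- The pointwise cartesian structure on a product of categories. -/
noncomputable abbrev piCMC {I : Type w} (C : I → Type u) [∀ i, Category.{v} (C i)]
    [∀ i, CartesianMonoidalCategory (C i)] : CartesianMonoidalCategory (∀ i, C i) where
  isTerminalTensorUnit := IsTerminal.ofUniqueHom (fun X i => toUnit (X i))
      (fun X m => funext fun i => toUnit_unique _ _)
  fst A B i := fst (A i) (B i)
  snd A B i := snd (A i) (B i)
  fst_def A B := funext fun i => fst_def (A i) (B i)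
  snd_def A B := funext fun i => snd_def (A i) (B i)
  tensorProductIsBinaryProduct A B :=
    BinaryFan.IsLimit.mk _
        (fun f g i => lift (f i) (g i))
        (fun f g => funext fun i => lift_fst _ _)
        (fun f g => funext fun i => lift_snd _ _)
        (fun f g m hf hg => by
          subst hf hg
          funext i
          apply CartesianMonoidalCategory.hom_ext
          · exact (lift_fst _ _).symm
          · exact (lift_snd _ _).symm)

theorem pi_ccp {I : Type w} (C : I → Type u) [∀ i, Category.{v} (C i)]
    (h : ∀ i, CartesianClosedP (C i)) : CartesianClosedP (∀ i, C i) := by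
  let _ : ∀ i, CartesianMonoidalCategory (C i) := fun i => (h i).choose
  let _ := piCMC C
  have h' := fun i => ccp_iff.1 (h i)
  rw [ccp_iff]
  choose E ev hE using h'
  intro A B
  refine ⟨fun i => E i (A i) (B i), fun i => ev i (A i) (B i), fun X f => ?_⟩
  choose cur hcur huniq using hE
  refine ⟨fun i => cur i _ _ _ (f i), ?_, ?_⟩
  · funext i
    exact hcur i _ _ _ (f i)
  · intro g hg
    funext i
    exact huniq i _ _ _ _ _ (congrFun hg i)

section
variable {K : Type u} [Category.{v} K]
open Opposite

/-- Concrete presheaf attached to a family. -/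
def famPsh {J : Type v} (B : J → K) : Kᵒᵖ ⥤ Type v where
  obj A := Σ j, (A.unop ⟶ B j)
  map f := ↾fun p => ⟨p.1, f.unop ≫ p.2⟩

/-- The injections. -/
def famInj {J : Type v} (B : J → K) (j : J) : yoneda.obj (B j) ⟶ famPsh B where
  app A := ↾fun f => ⟨j, f⟩

theorem existsUnique_hom_coprod {J : Type v} (B : J → K) {A : K}
    (m : yoneda.obj A ⟶ ∐ fun j => yoneda.obj (B j)) :
    ∃! p : Σ j, (A ⟶ B j), yoneda.map p.2 ≫ Sigma.ι (fun j => yoneda.obj (B j)) p.1 = m := by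
  let e : (∐ fun j => yoneda.obj (B j)) ⟶ famPsh B := Sigma.desc (famInj B)
  let d : famPsh B ⟶ ∐ fun j => yoneda.obj (B j) :=
    { app := fun X => ↾fun p => (Sigma.ι (fun j => yoneda.obj (B j)) p.1).app X p.2
      naturality := by
        intro X Y f
        ext ⟨j, p⟩
        exact (NatTrans.naturality_apply (Sigma.ι (fun j => yoneda.obj (B j)) j) f p) }
  have hed : e ≫ d = 𝟙 _ := by
    apply Sigma.hom_ext
    intro j
    rw [Category.comp_id, Sigma.ι_desc_assoc]
    rfl
  have hι : ∀ p : Σ j, (A ⟶ B j),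
      yonedaEquiv ((yoneda.map p.2 ≫ Sigma.ι (fun j => yoneda.obj (B j)) p.1) ≫ e) = p := by
    rintro ⟨j, p⟩
    rw [Category.assoc, Sigma.ι_desc, yonedaEquiv_comp, yonedaEquiv_yoneda_map]
    rfl
  let q : Σ j, (A ⟶ B j) := yonedaEquiv (m ≫ e)
  refine ⟨q, ?_, ?_⟩
  · have : Mono e := by
      have : Mono (e ≫ d) := by rw [hed]; infer_instance
      exact mono_of_mono e d
    beta_reduce
    rw [← cancel_mono e]
    exact yonedaEquiv.injective (hι _)
  · rintro p rfl
    exact (hι p).symm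

open FormalCoproduct in
/-- Comparison functor. -/
noncomputable def fcToSigma (K : Type u) [Category.{v} K] :
    FormalCoproduct.{v} K ⥤ SigmaCompletion K :=
  ObjectProperty.lift _ (FormalCoproduct.yoneda (C := K)) (fun X => ⟨X.I, X.obj, ⟨Iso.refl _⟩⟩)

open FormalCoproduct in
theorem ι_yoneda_map {X Y : FormalCoproduct.{v} K} (f : X ⟶ Y) (i : X.I) :
    Sigma.ι (fun i => yoneda.obj (X.obj i)) i ≫ (FormalCoproduct.yoneda (C := K)).map f =
      yoneda.map (f.φ i) ≫ Sigma.ι (fun j => yoneda.obj (Y.obj j)) (f.f i) :=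
  Sigma.ι_desc _ _

open FormalCoproduct in
instance : (FormalCoproduct.yoneda (C := K)).Faithful where
  map_injective {X Y f g} h := by
    rw [hom_ext_iff']
    intro i
    have h' := congrArg (fun m => Sigma.ι (fun i => yoneda.obj (X.obj i)) i ≫ m) h
    beta_reduce at h'
    rw [ι_yoneda_map, ι_yoneda_map] at h'
    have := (existsUnique_hom_coprod Y.obj _).unique
      (y₁ := ⟨f.f i, f.φ i⟩) (y₂ := ⟨g.f i, g.φ i⟩) h' rfl
    rw [Sigma.mk.injEq] at this
    refine ⟨this.1, ?_⟩
    obtain ⟨h1, h2⟩ := this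
    exact eq_of_heq ((comp_eqToHom_heq _ _).trans h2)

open FormalCoproduct in
instance : (FormalCoproduct.yoneda (C := K)).Full where
  map_surjective {X Y} m := by
    have h := fun i => existsUnique_hom_coprod Y.obj
      (Sigma.ι (fun i => yoneda.obj (X.obj i)) i ≫ m)
    choose p hp _ using h
    refine ⟨⟨fun i => (p i).1, fun i => (p i).2⟩, ?_⟩
    apply Sigma.hom_ext
    intro i
    exact (ι_yoneda_map _ _).trans (hp i)

instance : (fcToSigma K).IsEquivalence where
  faithful := ⟨fun {X Y f g} h => (FormalCoproduct.yoneda (C := K)).map_injective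
    (congrArg (ObjectProperty.ι _).map h)⟩
  full := ⟨fun {X Y} m => by
    obtain ⟨f, hf⟩ := (FormalCoproduct.yoneda (C := K)).map_surjective
      ((ObjectProperty.ι _).map m)
    exact ⟨f, (ObjectProperty.ι _).map_injective hf⟩⟩
  essSurj := ⟨fun F => by
    obtain ⟨I, A, ⟨e⟩⟩ := F.property
    exact ⟨⟨I, A⟩, ⟨ObjectProperty.isoMk _ e.symm⟩⟩⟩

/-- The equivalence of the two models of the free coproduct completion. -/
noncomputable def fcEquivSigma (K : Type u) [Category.{v} K] :
    FormalCoproduct.{v} K ≌ SigmaCompletion K := (fcToSigma K).asEquivalence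

end

section
open FormalCoproduct
variable {K : Type u} [Category.{v} K] (X : FormalCoproduct.{w} K)

variable {X} in
/-- Gluing, on objects. -/
def glueObj (Y : ∀ i : X.I, FormalCoproduct.{w} (Over (X.obj i))) : FormalCoproduct.{w} K :=
  ⟨Σ i, (Y i).I, fun p => ((Y p.1).obj p.2).left⟩

variable {X} in
/-- Gluing, on objects: the structure map. -/
def glueHom (Y : ∀ i : X.I, FormalCoproduct.{w} (Over (X.obj i))) : glueObj Y ⟶ X :=
  Hom.mk (X := glueObj Y) (Y := X) Sigma.fst (fun p => ((Y p.1).obj p.2).hom)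

variable {X} in
/-- Gluing, on morphisms. -/
def glueMap {Y Y' : ∀ i : X.I, FormalCoproduct.{w} (Over (X.obj i))} (g : ∀ i, Y i ⟶ Y' i) :
    glueObj Y ⟶ glueObj Y' :=
  Hom.mk (X := glueObj Y) (Y := glueObj Y') (fun p => ⟨p.1, (g p.1).f p.2⟩)
    (fun p => ((g p.1).φ p.2).left)

/-- Gluing a family of families over the components of `X`. -/
def overGlue : (∀ i : X.I, FormalCoproduct.{w} (Over (X.obj i))) ⥤ Over X where
  obj Y := Over.mk (glueHom Y)
  map {Y Y'} g := Over.homMk (glueMap g)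
    (by
      refine hom_ext rfl fun p => ?_
      exact (Category.comp_id _).trans (Over.w ((g p.1).φ p.2)))
  map_id Y := rfl
  map_comp f g := rfl

instance : (overGlue X).Faithful where
  map_injective {Y Y' f g} h := by
    funext i
    rw [hom_ext_iff']
    intro l
    have h1 := congrArg CommaMorphism.left h
    obtain ⟨h2, h3⟩ := (hom_ext_iff' (glueMap f) (glueMap g)).1 h1 (Sigma.mk i l)
    have h2' : (f i).f l = (g i).f l := by
      exact eq_of_heq (Sigma.mk.inj h2).2
    refine ⟨h2', ?_⟩
    apply Over.OverMorphism.ext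
    rw [Over.comp_left, Over.eqToHom_left]
    exact h3

instance : (overGlue X).Full where
  map_surjective {Y Y'} m := by
    have key : ∀ (i : X.I) (l : (Y i).I) (q : Σ i, (Y' i).I)
        (φ : ((Y i).obj l).left ⟶ ((Y' q.1).obj q.2).left) (hq : q.1 = i),
        (φ ≫ ((Y' q.1).obj q.2).hom) ≫ eqToHom (by rw [hq]) = ((Y i).obj l).hom →
        ∃ (l' : (Y' i).I) (ψ : (Y i).obj l ⟶ (Y' i).obj l') (hh : ⟨i, l'⟩ = q),
          ψ.left ≫ eqToHom (by rw [← hh]) = φ := by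
      rintro i l ⟨i', l'⟩ φ rfl h
      exact ⟨l', Over.homMk φ (by simpa using h), rfl, by simp⟩
    let n : glueObj Y ⟶ glueObj Y' := m.left
    have hw := (hom_ext_iff' (n ≫ glueHom Y') (glueHom Y)).1 (Over.w m)
    have key2 := fun i l => key i l (n.f (Sigma.mk i l)) (n.φ (Sigma.mk i l))
      (hw (Sigma.mk i l)).1 (hw (Sigma.mk i l)).2
    choose l' ψ hh hψ using key2
    let g : ∀ i, Y i ⟶ Y' i := fun i => ⟨l' i, ψ i⟩
    refine ⟨g, ?_⟩
    apply Over.OverMorphism.ext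
    refine (hom_ext_iff' (glueMap g) n).2 ?_
    rintro ⟨i, l⟩
    exact ⟨hh i l, hψ i l⟩

instance : (overGlue X).EssSurj where
  mem_essImage Z := by
    let h : Z.left ⟶ X := Z.hom
    let Y : ∀ i : X.I, FormalCoproduct.{w} (Over (X.obj i)) := fun i =>
      ⟨{l : Z.left.I // h.f l = i}, fun l => Over.mk (h.φ l.1 ≫ eqToHom (by rw [l.2]))⟩
    let e : glueObj Y ≅ Z.left :=
      isoOfComponents (X := glueObj Y) (Equiv.sigmaFiberEquiv h.f) (fun p => Iso.refl _)
    have he : e.hom ≫ h = glueHom Y := by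
      rw [hom_ext_iff']
      rintro ⟨i, l, rfl⟩
      refine ⟨rfl, ?_⟩
      change (𝟙 _ ≫ h.φ l) ≫ 𝟙 _ = h.φ l ≫ 𝟙 _
      simp
    exact ⟨Y, ⟨Over.isoMk e he⟩⟩

instance : (overGlue X).IsEquivalence where

end

section
variable {K : Type u} [Category.{v} K]

instance [HasInitial K] (A : K) : HasInitial (Over A) := inferInstance

theorem over_strict [HasInitial K] [HasStrictInitialObjects K] (A : K) :
    HasStrictInitialObjects (Over A) := by
  have hI : IsInitial (Over.mk (initial.to A)) :=
    IsInitial.ofUniqueHom (fun Z => Over.homMk (initial.to _) (initial.hom_ext _ _))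
      (fun Z m => Over.OverMorphism.ext (initial.hom_ext _ _))
  constructor
  intro I Z f hZ
  have e := hZ.uniqueUpToIso hI
  have hl : IsInitial I.left := initialIsInitial.ofIso ((Over.forget A).mapIso e).symm
  have : IsIso f.left := HasStrictInitialObjects.out f.left hl
  have : IsIso ((Over.forget A).map f) := this
  exact isIso_of_reflects_iso f (Over.forget A)

theorem fc_ccp_iff (L : Type u) [Category.{v} L] [HasProducts.{w} L] [HasInitial L]
    [HasStrictInitialObjects L] :
    CartesianClosedP (FormalCoproduct.{w} L) ↔ CartesianClosedP L := by
  have : HasFiniteProducts L := hasFiniteProducts_of_hasProducts.{w} L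
  let _ := CartesianMonoidalCategory.ofHasFiniteProducts (C := L)
  exact ⟨ccp_of_fc, fc_ccp⟩

end

theorem lccp_of_equiv {C : Type u} [Category.{v} C]
    {D : Type u'} [Category.{v'} D] (e : D ≌ C)
    (h : LocallyCartesianClosedP D) : LocallyCartesianClosedP C := fun A =>
  (h _).of_equiv (Over.postEquiv A e.symm).symm

theorem fc_lccp_iff (K : Type u) [Category.{v} K]
    [HasLimits K] [HasInitial K] [HasStrictInitialObjects K] :
    LocallyCartesianClosedP (FormalCoproduct.{v} K) ↔ LocallyCartesianClosedP K := by
  have hs := fun A : K => over_strict A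
  have hp : ∀ A : K, HasProducts.{v} (Over A) := fun A J =>
    Over.ConstructProducts.over_product_of_widePullback
  constructor
  · intro h A
    rw [← fc_ccp_iff.{v}]
    have h1 := (h ((FormalCoproduct.incl K).obj A)).of_equiv
      (overGlue ((FormalCoproduct.incl K).obj A)).asEquivalence.symm
    have e : (∀ _ : PUnit.{v+1}, FormalCoproduct.{v} (Over A)) ≌ FormalCoproduct.{v} (Over A) :=
      { functor := Pi.eval _ PUnit.unit
        inverse := { obj := fun Y _ => Y, map := fun f _ => f }
        unitIso := Iso.refl _
        counitIso := Iso.refl _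
        functor_unitIso_comp := fun _ => Category.comp_id _ }
    exact h1.of_equiv e
  · intro h X
    refine CartesianClosedP.of_equiv (overGlue X).asEquivalence (pi_ccp _ fun i => ?_)
    rw [fc_ccp_iff]
    exact h _

theorem final (K : Type u) [Category.{v} K]
    [HasLimits K] [HasInitial K] [HasStrictInitialObjects K] :
    (CartesianClosedP (SigmaCompletion K) ↔ CartesianClosedP K) ∧
    (LocallyCartesianClosedP (SigmaCompletion K) ↔ LocallyCartesianClosedP K) := by
  rw [← fc_ccp_iff.{v} K, ← fc_lccp_iff K]
  exact ⟨⟨fun h => h.of_equiv (fcEquivSigma K).symm, fun h => h.of_equiv (fcEquivSigma K)⟩,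
    ⟨lccp_of_equiv (fcEquivSigma K).symm, lccp_of_equiv (fcEquivSigma K)⟩⟩

end Helpers

/-- Corollary 2.13: for a complete category `𝒦` with a strict initial
object, `Σ𝒦` is (locally) cartesian closed iff `𝒦` is (locally) cartesian closed. -/
theorem sigmaCompletion_cc_and_lcc_iff_of_strictInitial (K : Type u) [Category.{v} K]
    [HasLimits K] [HasInitial K] [HasStrictInitialObjects K] :
    (CartesianClosedP (SigmaCompletion K) ↔ CartesianClosedP K) ∧
    (LocallyCartesianClosedP (SigmaCompletion K) ↔ LocallyCartesianClosedP K) := by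
  exact final K
end FreeCompletions
end

section
/- Let 𝒦 be a category with a strict initial object and finite products. Then 𝒦 is cartesian closed if and only if 𝒦 is cartesian multi-closed. -/
/- Common definitions for formalizing "How nice are free completions of categories?"
   by Adámek and Rosický. -/

open CategoryTheory CategoryTheory.Limits

universe w w₁ w₂ v₁ u₁

namespace FreeCompletions

universe v u

/-- The canonical isomorphism between the chosen tensor and the categorical product. -/
noncomputable def tensorIsoProd {K : Type u} [Category.{v} K] [CartesianMonoidalCategory K]
    [HasFiniteProducts K] (A X : K) : MonoidalCategory.tensorObj A X ≅ A ⨯ X where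
  hom := prod.lift (SemiCartesianMonoidalCategory.fst A X) (SemiCartesianMonoidalCategory.snd A X)
  inv := CartesianMonoidalCategory.lift prod.fst prod.snd
  hom_inv_id := by
    apply CartesianMonoidalCategory.hom_ext
    · simpa using prod.lift_fst _ _
    · simpa using prod.lift_snd _ _
  inv_hom_id := by
    apply Limits.prod.hom_ext <;> simp

theorem tensorIsoProd_naturality {K : Type u} [Category.{v} K] [CartesianMonoidalCategory K]
    [HasFiniteProducts K] (A : K) {X Y : K} (g : X ⟶ Y) :
    prod.map (𝟙 A) g ≫ (tensorIsoProd A Y).inv =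
      (tensorIsoProd A X).inv ≫ MonoidalCategory.whiskerLeft A g := by
  apply CartesianMonoidalCategory.hom_ext <;> simp [tensorIsoProd]

theorem closed_of_multiClosed {K : Type u} [Category.{v} K]
    [HasInitial K] [HasStrictInitialObjects K] [HasFiniteProducts K]
    (H : CartesianMultiClosedOf K) (A B : K) :
    ∃ (E : K) (ev : A ⨯ E ⟶ B), ∀ (X : K) (c : A ⨯ X ⟶ B),
      ∃! g : X ⟶ E, prod.map (𝟙 A) g ≫ ev = c := by
  obtain ⟨I, E, ev, h⟩ := H A B
  have : IsIso (prod.snd : A ⨯ ⊥_ K ⟶ ⊥_ K) := inferInstance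
  have hi : IsInitial (A ⨯ ⊥_ K) :=
    initialIsInitial.ofIso (asIso (prod.snd : A ⨯ ⊥_ K ⟶ ⊥_ K)).symm
  obtain ⟨p₀, -, hp₀⟩ := h (⊥_ K) (hi.to B)
  refine ⟨E p₀.1, ev p₀.1, fun X c => ?_⟩
  obtain ⟨⟨i, g⟩, hg, hu⟩ := h X c
  have hi₀ : i = p₀.1 := congrArg Sigma.fst (hp₀ ⟨i, initial.to _⟩ (hi.hom_ext _ _))
  subst hi₀
  refine ⟨g, hg, fun g' hg' => ?_⟩
  have := hu ⟨p₀.1, g'⟩ hg'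
  simpa using this

/-- Remark 2.8: a category with a strict initial object and finite
products is cartesian closed iff it is cartesian multi-closed. -/
theorem cartesianClosed_iff_cartesianMultiClosed (K : Type u) [Category.{v} K]
    [HasInitial K] [HasStrictInitialObjects K] [HasFiniteProducts K] :
    CartesianClosedP K ↔ CartesianMultiClosedOf K := by
  constructor
  · rintro ⟨h, ⟨hc⟩⟩ A B
    refine ⟨PUnit, fun _ => (ihom A).obj B,
      fun _ => (tensorIsoProd A _).inv ≫ (ihom.ev A).app B, fun X c => ?_⟩
    have key : ∀ g : X ⟶ (ihom A).obj B,
        prod.map (𝟙 A) g ≫ (tensorIsoProd A _).inv ≫ (ihom.ev A).app B = c ↔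
          g = MonoidalClosed.curry ((tensorIsoProd A X).hom ≫ c) := by
      intro g
      rw [← Category.assoc, tensorIsoProd_naturality, Category.assoc,
        ← MonoidalClosed.uncurry_eq, Iso.inv_comp_eq, MonoidalClosed.eq_curry_iff]
    refine ⟨⟨PUnit.unit, MonoidalClosed.curry ((tensorIsoProd A X).hom ≫ c)⟩,
      (key _).2 rfl, ?_⟩
    rintro ⟨⟨⟩, g⟩ hg
    rw [(key g).1 hg]
  · intro H
    letI h : CartesianMonoidalCategory K := CartesianMonoidalCategory.ofHasFiniteProducts
    refine ⟨h, ⟨⟨fun A => ?_⟩⟩⟩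
    choose E ev hE using closed_of_multiClosed H A
    let e : ∀ X Y : K, ((MonoidalCategory.tensorLeft A).obj X ⟶ Y) ≃ (X ⟶ E Y) := fun X Y =>
      (Equiv.ofBijective
        (fun g : X ⟶ E Y => (tensorIsoProd A X).hom ≫ prod.map (𝟙 A) g ≫ ev Y) (by
          constructor
          · intro g g' hg
            exact (hE Y X _).unique ((cancel_epi (tensorIsoProd A X).hom).1 hg) rfl
          · intro c
            obtain ⟨g, hg, -⟩ := hE Y X ((tensorIsoProd A X).inv ≫ c)
            exact ⟨g, by simp [hg]⟩)).symm
    have he : ∀ X' X Y f g, e X' Y ((MonoidalCategory.tensorLeft A).map f ≫ g) = f ≫ e X Y g := by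
      intro X' X Y f g
      obtain ⟨g, rfl⟩ := (e X Y).symm.surjective g
      rw [← Equiv.eq_symm_apply, Equiv.apply_symm_apply]
      have := tensorIsoProd_naturality A f
      rw [Iso.comp_inv_eq, Category.assoc, Iso.eq_inv_comp] at this
      change MonoidalCategory.whiskerLeft A f ≫ (tensorIsoProd A X).hom ≫
          prod.map (𝟙 A) g ≫ ev Y = (tensorIsoProd A X').hom ≫ prod.map (𝟙 A) (f ≫ g) ≫ ev Y
      rw [← Category.assoc, ← this, prod.map_id_comp]
      simp only [Category.assoc]
    exact ⟨_, Adjunction.adjunctionOfEquivRight e he⟩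
end FreeCompletions
end
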